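/- arXiv:math/0410598 — 3 statements merged into one kernel-verified Lean document; each statement's English description precedes it below -/
import Mathlib

section
/- Let a be an ideal of R, M a weakly Laskerian R-module, and t ≥ 0 an integer such that H_a^i(M) is a-cofinite for all i < t. Then Ass_R(H_a^t(M)) and Ass_R(Ext_R^1(R/a, H_a^t(M))) are finite sets. -/
open CategoryTheory

/-- An `R`-module `M` is weakly Laskerian if every quotient of `M`
has finitely many associated primes. -/
def WeaklyLaskerian (R M : Type*) [CommRing R] [AddCommGroup M] [Module R M] : Prop :=
  ∀ N : Submodule R M, (associatedPrimes R (M ⧸ N)).Finite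

/-- `Ext_R^j(R/a, N)` for a module `N` in `ModuleCat R`. -/
noncomputable def extMod {R : Type} [CommRing R] (a : Ideal R) (j : ℕ)
    (N : ModuleCat.{0} R) : ModuleCat.{0} R :=
  ((Ext R (ModuleCat.{0} R) j).obj (Opposite.op (ModuleCat.of R (R ⧸ a)))).obj N

/-- An object `N` of `ModuleCat R` is `a`-cofinite if `Supp N ⊆ V(a)` and all
`Ext^i_R(R/a, N)` are finitely generated. -/
def IsCofinite {R : Type} [CommRing R] (a : Ideal R) (N : ModuleCat.{0} R) : Prop :=
  Module.support R N ⊆ PrimeSpectrum.zeroLocus (a : Set R) ∧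
    ∀ i : ℕ, Module.Finite R (extMod a i N)

open Abelian

theorem exists_linearEquiv_of_ker_eq {R A B C : Type*} [Ring R] [AddCommGroup A] [AddCommGroup B]
    [AddCommGroup C] [Module R A] [Module R B] [Module R C] (p : A →ₗ[R] B) (q : A →ₗ[R] C)
    (hp : Function.Surjective p) (hq : Function.Surjective q)
    (h : LinearMap.ker p = LinearMap.ker q) : ∃ e : B ≃ₗ[R] C, ∀ x, e (p x) = q x := by
  refine ⟨(p.quotKerEquivOfSurjective hp).symm ≪≫ₗ Submodule.quotEquivOfEq _ _ h ≪≫ₗ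
    q.quotKerEquivOfSurjective hq, fun x ↦ ?_⟩
  have : (p.quotKerEquivOfSurjective hp).symm (p x) = (LinearMap.ker p).mkQ x := by
    rw [LinearEquiv.symm_apply_eq]; rfl
  simp only [LinearEquiv.trans_apply, this]
  rfl

section
variable {R : Type} [CommRing R] {X Y : ModuleCat.{0} R} (P : ProjectiveResolution X)

theorem extMk_zero_iff (f : P.complex.X 0 ⟶ Y) (hf : P.complex.d 1 0 ≫ f = 0) :
    P.extMk f 1 rfl hf = 0 ↔ f = 0 := by
  constructor
  · intro h
    rw [← P.extEquivCohomologyClass.apply_eq_iff_eq,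
      ProjectiveResolution.extEquivCohomologyClass_extMk,
      ProjectiveResolution.extEquivCohomologyClass_zero,
      CochainComplex.HomComplex.CohomologyClass.mk_eq_zero_iff,
      CochainComplex.HomComplex.Cocycle.toSingleMk_mem_coboundaries_iff _ _ _ _ _ 1 (by lia)] at h
    obtain ⟨g, hg⟩ := h
    have : Limits.IsZero (P.cochainComplex.X 1) :=
      CochainComplex.isZero_of_isStrictlyLE _ 0 1 (by lia)
    rw [this.eq_of_src g 0] at hg
    rw [← cancel_epi (P.cochainComplexXIso (-(0:ℕ)) 0 rfl).hom]
    simpa using hg.symm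
  · rintro rfl
    simp

variable (Y) in
/-- A cycle of the Hom-complex, as a morphism out of the resolution. -/
noncomputable def cycHom (n : ℕ) :
    (P.complex.linearYonedaObj R Y).cycles n →ₗ[R] (P.complex.X n ⟶ Y) :=
  ((P.complex.linearYonedaObj R Y).iCycles n).hom

theorem d_comp_cycHom (n : ℕ) (c : (P.complex.linearYonedaObj R Y).cycles n) :
    P.complex.d (n + 1) n ≫ cycHom Y P n c = 0 :=
  ConcreteCategory.congr_hom ((P.complex.linearYonedaObj R Y).iCycles_d n (n + 1)) c

theorem cycHom_injective (n : ℕ) : Function.Injective (cycHom (R := R) Y P n) :=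
  (ModuleCat.mono_iff_injective ((P.complex.linearYonedaObj R Y).iCycles n)).mp inferInstance

theorem exists_cycHom_eq (n : ℕ) (f : P.complex.X n ⟶ Y) (hf : P.complex.d (n + 1) n ≫ f = 0) :
    ∃ c, cycHom (R := R) Y P n c = f := by
  have := (ShortComplex.moduleCat_exact_iff _).mp
    (ShortComplex.exact_of_f_is_kernel (ShortComplex.mk _ _
      ((P.complex.linearYonedaObj R Y).iCycles_d n (n + 1)))
      ((P.complex.linearYonedaObj R Y).cyclesIsKernel n (n + 1) (by simp)))
  exact this f hf

variable (Y) in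
/-- The `Ext`-class of a cycle of the Hom-complex. -/
noncomputable def extCyc (n : ℕ) : (P.complex.linearYonedaObj R Y).cycles n →ₗ[R] Ext X Y n where
  toFun c := P.extMk (cycHom Y P n c) (n + 1) rfl (d_comp_cycHom P n c)
  map_add' c c' := by
    rw [ProjectiveResolution.add_extMk]
    congr 1
    exact map_add _ _ _
  map_smul' r c := by
    rw [RingHom.id_apply, Ext.smul_eq_comp_mk₀, ProjectiveResolution.extMk_comp_mk₀]
    congr 1
    rw [map_smul, Linear.comp_smul, Category.comp_id]

theorem extCyc_surjective (n : ℕ) : Function.Surjective (extCyc (R := R) Y P n) := fun x ↦ by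
  obtain ⟨f, hf, rfl⟩ := P.extMk_surjective x (n + 1) rfl
  obtain ⟨c, rfl⟩ := exists_cycHom_eq (R := R) P n f hf
  exact ⟨c, rfl⟩

variable (Y) in
/-- The projection from cycles to homology of the Hom-complex. -/
noncomputable def homologyProj (n : ℕ) : (P.complex.linearYonedaObj R Y).cycles n →ₗ[R]
    (P.complex.linearYonedaObj R Y).homology n := ((P.complex.linearYonedaObj R Y).homologyπ n).hom

theorem homologyProj_surjective (n : ℕ) : Function.Surjective (homologyProj (R := R) Y P n) :=
  (ModuleCat.epi_iff_surjective ((P.complex.linearYonedaObj R Y).homologyπ n)).mp inferInstance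

theorem ker_homologyProj (n : ℕ) :
    LinearMap.ker (homologyProj (R := R) Y P n) = LinearMap.ker (extCyc Y P n) := by
  ext c
  simp only [LinearMap.mem_ker]
  have hex (i : ℕ) (hi : (ComplexShape.up ℕ).prev n = i) := (ShortComplex.moduleCat_exact_iff _).mp
    (ShortComplex.exact_of_g_is_cokernel (ShortComplex.mk _ _
      ((P.complex.linearYonedaObj R Y).toCycles_comp_homologyπ i n))
      ((P.complex.linearYonedaObj R Y).homologyIsCokernel i n hi))
  have hz (i : ℕ) (b) : homologyProj Y P n ((P.complex.linearYonedaObj R Y).toCycles i n b) = 0 :=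
    ConcreteCategory.congr_hom ((P.complex.linearYonedaObj R Y).toCycles_comp_homologyπ i n) b
  have hd (i : ℕ) (b : P.complex.X i ⟶ Y) : cycHom (R := R) Y P n
      ((P.complex.linearYonedaObj R Y).toCycles i n b) = P.complex.d n i ≫ b :=
    ConcreteCategory.congr_hom ((P.complex.linearYonedaObj R Y).toCycles_i i n) b
  obtain _ | n := n
  · refine Iff.trans ?_ (extMk_zero_iff P _ (d_comp_cycHom P 0 c)).symm
    constructor
    · intro h
      obtain ⟨b, rfl⟩ := hex 0 (by simp) c h
      exact (hd 0 b).trans ((congrArg (· ≫ b) (P.complex.shape 0 0 (by simp))).trans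
        Limits.zero_comp)
    · intro h
      rw [show c = 0 from cycHom_injective P 0 (h.trans (map_zero _).symm), map_zero]
  · refine Iff.trans ?_ (P.extMk_eq_zero_iff _ _ rfl (d_comp_cycHom P (n + 1) c) n rfl).symm
    constructor
    · intro h
      obtain ⟨b, rfl⟩ := hex n (by simp) c h
      exact ⟨b, (hd n b).symm⟩
    · rintro ⟨b, hb⟩
      exact cycHom_injective P (n + 1) ((hd n b).trans hb) ▸ hz n b

theorem exists_homologyEquiv (n : ℕ) :
    ∃ e : (P.complex.linearYonedaObj R Y).homology n ≃ₗ[R] Ext X Y n,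
      ∀ c, e (homologyProj Y P n c) = extCyc Y P n c :=
  exists_linearEquiv_of_ker_eq _ _ (homologyProj_surjective P n) (extCyc_surjective P n)
    (ker_homologyProj P n)

variable (Y) in
/-- The homology of the Hom-complex is `Ext`. -/
noncomputable def homologyEquiv (n : ℕ) :
    (P.complex.linearYonedaObj R Y).homology n ≃ₗ[R] Ext X Y n :=
  (exists_homologyEquiv P n).choose

theorem homologyEquiv_homologyProj (n : ℕ) (c) :
    homologyEquiv Y P n (homologyProj Y P n c) = extCyc Y P n c :=
  (exists_homologyEquiv P n).choose_spec c

variable (X Y) in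
/-- The derived functor `Ext` agrees with `Abelian.Ext`. -/
noncomputable def extEquiv (n : ℕ) :
    ((Ext R (ModuleCat.{0} R) n).obj (Opposite.op X)).obj Y ≃ₗ[R] Abelian.Ext X Y n :=
  ((projectiveResolution X).isoExt n Y).toLinearEquiv ≪≫ₗ
    homologyEquiv Y (projectiveResolution X) n

/-- The map of Hom-complexes induced by a map of resolutions. -/
noncomputable def linearYonedaObjMap {X' : ModuleCat.{0} R} {P' : ProjectiveResolution X'}
    {P : ProjectiveResolution X} (φ : P'.complex ⟶ P.complex) :
    P.complex.linearYonedaObj R Y ⟶ P'.complex.linearYonedaObj R Y :=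
  (HomologicalComplex.unopFunctor _ _).map
    ((((linearYoneda R (ModuleCat.{0} R)).obj Y).rightOp.mapHomologicalComplex _).map φ).op

theorem isoExt_hom_naturality (n : ℕ) {X' : ModuleCat.{0} R} (P' : ProjectiveResolution X')
    {g : X' ⟶ X} (φ : P'.Hom P g) :
    ((Ext R (ModuleCat.{0} R) n).map g.op).app Y ≫ (P'.isoExt n Y).hom =
      (P.isoExt n Y).hom ≫ HomologicalComplex.homologyMap (linearYonedaObjMap φ.hom) n := by
  have h := P'.isoLeftDerivedObj_inv_naturality g P φ.hom
    (by simpa using φ.hom_f_zero_comp_π_f_zero) ((linearYoneda R (ModuleCat.{0} R)).obj Y).rightOp n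
  have h₁ := congrArg Quiver.Hom.unop h
  have h₂ := congrArg Quiver.Hom.unop (ShortComplex.homologyOpIso_inv_naturality
    ((HomologicalComplex.shortComplexFunctor _ _ n).map
      (linearYonedaObjMap (R := R) (Y := Y) φ.hom)))
  refine (Category.assoc _ _ _).symm.trans ?_
  refine (congrArg (· ≫ (HomologicalComplex.homologyUnop _ _).inv) h₁).trans ?_
  refine (Category.assoc _ _ _).trans (Eq.trans ?_ (Category.assoc _ _ _).symm)
  exact congrArg (_ ≫ ·) h₂.symm

theorem cycHom_cyclesMap (n : ℕ) {X' : ModuleCat.{0} R} (P' : ProjectiveResolution X')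
    {g : X' ⟶ X} (φ : P'.Hom P g) (c) :
    cycHom Y P' n (HomologicalComplex.cyclesMap (linearYonedaObjMap φ.hom) n c) =
      φ.hom.f n ≫ cycHom (R := R) Y P n c :=
  ConcreteCategory.congr_hom (HomologicalComplex.cyclesMap_i (linearYonedaObjMap φ.hom) n) c

theorem extEquiv_naturality (n : ℕ) {X' : ModuleCat.{0} R} (g : X' ⟶ X)
    (z : ((Ext R (ModuleCat.{0} R) n).obj (Opposite.op X)).obj Y) :
    extEquiv X' Y n (((Ext R (ModuleCat.{0} R) n).map g.op).app Y z) =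
      (Ext.mk₀ g).comp (extEquiv X Y n z) (zero_add n) := by
  let P := projectiveResolution X
  let P' := projectiveResolution X'
  let φ : P'.Hom P g := ⟨ProjectiveResolution.lift g P' P,
    HomologicalComplex.congr_hom (ProjectiveResolution.lift_commutes g P' P) 0⟩
  obtain ⟨c, hc⟩ := homologyProj_surjective (R := R) P n ((P.isoExt n Y).hom z)
  have h1 := ConcreteCategory.congr_hom (isoExt_hom_naturality (Y := Y) P n P' φ) z
  have h2 : extEquiv X Y n z = extCyc Y P n c :=
    (congrArg (homologyEquiv Y P n) hc.symm).trans (homologyEquiv_homologyProj P n c)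
  rw [h2]
  refine (congrArg (homologyEquiv Y P' n) h1).trans ?_
  refine (congrArg (fun w ↦ homologyEquiv Y P' n
    (HomologicalComplex.homologyMap (linearYonedaObjMap φ.hom) n w)) hc.symm).trans ?_
  refine (congrArg (homologyEquiv Y P' n) (ConcreteCategory.congr_hom
    (HomologicalComplex.homologyπ_naturality
      (linearYonedaObjMap (R := R) (Y := Y) φ.hom) n) c)).trans ?_
  refine (homologyEquiv_homologyProj P' n _).trans ?_
  refine Eq.trans ?_ (ProjectiveResolution.mk₀_comp_extMk _ (n + 1) rfl (d_comp_cycHom P n c) φ).symm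
  refine (?_ : P'.extMk (cycHom Y P' n _) (n + 1) rfl (d_comp_cycHom P' n _) = _)
  congr 1
  exact cycHom_cyclesMap P n P' φ c

end

section
variable {R : Type} [CommRing R] (a : Ideal R)

/-- The module `R ⧸ a ^ n`. -/
abbrev powQuot (n : ℕ) : ModuleCat.{0} R := ModuleCat.of R (R ⧸ a ^ n)

/-- The projection `R ⧸ a ^ m ⟶ R ⧸ a ^ n` for `n ≤ m`. -/
def powQuotMap {n m : ℕ} (h : n ≤ m) : powQuot a m ⟶ powQuot a n :=
  ModuleCat.ofHom (Submodule.mapQ _ _ LinearMap.id (Ideal.pow_le_pow_right h))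

theorem powQuotMap_self (n : ℕ) : powQuotMap a (le_refl n) = 𝟙 _ := by
  ext
  rfl

theorem powQuotMap_comp {n m k : ℕ} (h : n ≤ m) (h' : m ≤ k) :
    powQuotMap a h' ≫ powQuotMap a h = powQuotMap a (h.trans h') := by
  ext
  rfl

/-- The transition maps of the system defining local cohomology. -/
noncomputable def extPowMap (Y : ModuleCat.{0} R) (i n m : ℕ) (h : n ≤ m) :
    Ext (powQuot a n) Y i →ₗ[R] Ext (powQuot a m) Y i where
  toFun z := (Ext.mk₀ (powQuotMap a h)).comp z (zero_add i)
  map_add' _ _ := Ext.comp_add _ _ _ _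
  map_smul' _ _ := Ext.comp_smul _ _ _ _

theorem extPowMap_apply {Y : ModuleCat.{0} R} {i n m : ℕ} (h : n ≤ m)
    (z : Ext (powQuot a n) Y i) :
    extPowMap a Y i n m h z = (Ext.mk₀ (powQuotMap a h)).comp z (zero_add i) := rfl

instance (Y : ModuleCat.{0} R) (i : ℕ) : DirectedSystem (fun n ↦ Ext (powQuot a n) Y i)
    fun n m h ↦ extPowMap a Y i n m h where
  map_self n z := by simp [extPowMap, powQuotMap_self]
  map_map k n m h h' z := by
    simp [extPowMap, ← powQuotMap_comp a h h', ← Ext.mk₀_comp_mk₀_assoc]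

/-- Local cohomology, as the direct limit of the modules `Ext^i(R/a^n, Y)`. -/
abbrev LimExt (i : ℕ) (Y : ModuleCat.{0} R) : Type :=
  Module.DirectLimit (fun n ↦ Ext (powQuot a n) Y i) (extPowMap a Y i)

open Limits Opposite

theorem exists_localCohomologyEquiv (Y : ModuleCat.{0} R) (i : ℕ) :
    Nonempty ((localCohomology a i).obj Y ≃ₗ[R] LimExt a i Y) := by
  let F := localCohomology.diagram (localCohomology.idealPowersDiagram a) i
  let G := F ⋙ (evaluation _ _).obj Y
  let K : ModuleCat.{0} R := colimit G
  let e : (localCohomology a i).obj Y ≅ K := colimitObjIsoColimitCompEvaluation F Y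
  let v (n : ℕ) : ((_root_.Ext R (ModuleCat.{0} R) i).obj (op (powQuot a n))).obj Y →ₗ[R] K :=
    (colimit.ι G (op (op n))).hom
  let w (n : ℕ) : Ext (powQuot a n) Y i →ₗ[R] LimExt a i Y :=
    Module.DirectLimit.of R ℕ (fun n ↦ Ext (powQuot a n) Y i) (extPowMap a Y i) n
  let x (n : ℕ) := extEquiv (powQuot a n) Y i
  have hv (n m : ℕ) (h : n ≤ m) (z) : v m ((x m).symm (extPowMap a Y i n m h z)) =
      v n ((x n).symm z) := by
    obtain ⟨z, rfl⟩ := (x n).surjective z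
    refine (congrArg (fun t ↦ v m ((x m).symm t))
      (extEquiv_naturality i (powQuotMap a h) z).symm).trans ?_
    refine (congrArg (v m) ((x m).symm_apply_apply _)).trans ?_
    refine Eq.trans ?_ (congrArg (v n) ((x n).symm_apply_apply _)).symm
    exact ConcreteCategory.congr_hom (colimit.w G (homOfLE h).op.op) z
  have hw (n m : ℕ) (h : n ≤ m) (z) :
      w m (x m (((_root_.Ext R (ModuleCat.{0} R) i).map (powQuotMap a h).op).app Y z)) =
        w n (x n z) :=
    (congrArg (w m) (extEquiv_naturality i (powQuotMap a h) z)).trans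
      (Module.DirectLimit.of_f (hij := h))
  let f : LimExt a i Y →ₗ[R] K := Module.DirectLimit.lift _ _ _ _
    (fun n ↦ v n ∘ₗ (x n).symm.toLinearMap) hv
  let c : Cocone G :=
    { pt := ModuleCat.of R (LimExt a i Y)
      ι :=
      { app n := ModuleCat.ofHom (w n.unop.unop ∘ₗ (x n.unop.unop).toLinearMap)
        naturality n m h := ModuleCat.hom_ext (LinearMap.ext fun z ↦
          hw _ _ (leOfHom h.unop.unop) z) } }
  let g : K →ₗ[R] LimExt a i Y := (colimit.desc G c).hom
  have hg (n : ℕ) (z) : g (v n z) = w n (x n z) :=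
    ConcreteCategory.congr_hom (colimit.ι_desc c (op (op n))) z
  have hf (n : ℕ) (z) : f (w n z) = v n ((x n).symm z) := Module.DirectLimit.lift_of _ _ _
  have hfg : f ∘ₗ g = LinearMap.id := by
    have : ModuleCat.ofHom g ≫ ModuleCat.ofHom f = 𝟙 K :=
      colimit.hom_ext fun n ↦ ModuleCat.hom_ext (LinearMap.ext fun z ↦
        (congrArg f (hg n.unop.unop z)).trans ((hf _ _).trans
          (congrArg (v _) ((x _).symm_apply_apply z))))
    exact congrArg ModuleCat.Hom.hom this
  have hgf : g ∘ₗ f = LinearMap.id :=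
    Module.DirectLimit.hom_ext fun n ↦ LinearMap.ext fun z ↦
      (congrArg g (hf n z)).trans ((hg _ _).trans (congrArg (w n) ((x n).apply_symm_apply z)))
  exact ⟨e.toLinearEquiv ≪≫ₗ LinearEquiv.ofLinearMap g f hgf hfg⟩
end

section
variable {R : Type} [CommRing R] (a : Ideal R)

section
variable (M : Type*) [AddCommGroup M] [Module R M]

/-- The submodule of elements killed by some power of `a`. -/
def powTorsion : Submodule R M where
  carrier := {x | ∃ n, ∀ r ∈ a ^ n, r • x = 0}
  zero_mem' := ⟨0, fun _ _ ↦ smul_zero _⟩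
  add_mem' := by
    rintro x y ⟨n, hn⟩ ⟨m, hm⟩
    refine ⟨max n m, fun r hr ↦ ?_⟩
    rw [smul_add, hn r (Ideal.pow_le_pow_right (le_max_left n m) hr),
      hm r (Ideal.pow_le_pow_right (le_max_right n m) hr), add_zero]
  smul_mem' := by
    rintro c x ⟨n, hn⟩
    exact ⟨n, fun r hr ↦ by rw [smul_comm, hn r hr, smul_zero]⟩

variable {M}

variable {a} in
theorem map_mem_powTorsion {N : Type*} [AddCommGroup N] [Module R N] (f : M →ₗ[R] N) {x : M}
    (hx : x ∈ powTorsion a M) : f x ∈ powTorsion a N := by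
  obtain ⟨n, hn⟩ := hx
  exact ⟨n, fun r hr ↦ by rw [← map_smul, hn r hr, map_zero]⟩

variable {a} in
theorem exists_pow_smul_eq_zero {U : Submodule R M} (hU : U ≤ powTorsion a M) (hfg : U.FG) :
    ∃ n, ∀ r ∈ a ^ n, ∀ x ∈ U, r • x = 0 := by
  induction U, hfg using Submodule.fg_induction with
  | singleton x =>
    obtain ⟨n, hn⟩ := hU (Submodule.mem_span_singleton_self x)
    refine ⟨n, fun r hr y hy ↦ ?_⟩
    obtain ⟨c, rfl⟩ := Submodule.mem_span_singleton.mp hy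
    rw [smul_comm, hn r hr, smul_zero]
  | sup U V _ _ h₁ h₂ =>
    obtain ⟨n, hn⟩ := h₁ (le_sup_left.trans hU)
    obtain ⟨m, hm⟩ := h₂ (le_sup_right.trans hU)
    refine ⟨max n m, fun r hr y hy ↦ ?_⟩
    obtain ⟨u, hu, v, hv, rfl⟩ := Submodule.mem_sup.mp hy
    rw [smul_add, hn r (Ideal.pow_le_pow_right (le_max_left n m) hr) u hu,
      hm r (Ideal.pow_le_pow_right (le_max_right n m) hr) v hv, add_zero]

theorem mem_powTorsion_of_mkQ [IsNoetherianRing R] {x : M}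
    (hx : (powTorsion a M).mkQ x ∈ powTorsion a (M ⧸ powTorsion a M)) : x ∈ powTorsion a M := by
  obtain ⟨n, hn⟩ := hx
  have hU : Submodule.map (LinearMap.toSpanSingleton R M x) (a ^ n) ≤ powTorsion a M := by
    rintro _ ⟨r, hr, rfl⟩
    have := hn r hr
    rwa [← map_smul, Submodule.mkQ_apply, Submodule.Quotient.mk_eq_zero] at this
  obtain ⟨m, hm⟩ := exists_pow_smul_eq_zero hU (Submodule.FG.map _ (IsNoetherian.noetherian _))
  refine ⟨m + n, fun r hr ↦ ?_⟩
  rw [pow_add] at hr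
  induction hr using Submodule.mul_induction_on' with
  | mem_mul_mem r hr s hs => rw [mul_smul]; exact hm r hr _ ⟨s, hs, rfl⟩
  | add r _ s _ h₁ h₂ => rw [add_smul, h₁, h₂, add_zero]

end

theorem powTorsion_injective [IsNoetherianRing R] (E : Type) [AddCommGroup E] [Module R E]
    [Module.Injective R E] : Module.Injective R (powTorsion a E) := by
  refine Module.Baer.injective fun I g ↦ ?_
  obtain ⟨n, hn⟩ := exists_pow_smul_eq_zero (a := a) (Submodule.map_subtype_le _ g.range)
    (Submodule.FG.map _ (LinearMap.range_eq_map g ▸ Submodule.FG.map g Module.Finite.fg_top))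
  obtain ⟨k, hk⟩ := Ideal.exists_pow_inf_eq_pow_smul a (M := R) I
  have hg (x : R) (hx : x ∈ I) (hxa : x ∈ a ^ (n + k)) : g ⟨x, hx⟩ = 0 := by
    have h : x ∈ a ^ (n + k) • ⊤ ⊓ I := ⟨by simpa using hxa, hx⟩
    have h' : x ∈ a ^ n • I := by
      rw [hk _ (by lia), Nat.add_sub_cancel] at h
      exact Submodule.smul_mono le_rfl inf_le_right h
    have key : ∃ hx : x ∈ I, g ⟨x, hx⟩ = 0 := by
      refine Submodule.smul_induction_on (p := fun y ↦ ∃ hy : y ∈ I, g ⟨y, hy⟩ = 0) h'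
        (fun r hr s hs ↦ ⟨I.smul_mem r hs, Subtype.ext ?_⟩) ?_
      · rw [Submodule.coe_zero, ← hn r hr (g ⟨s, hs⟩) ⟨_, ⟨_, rfl⟩, rfl⟩, ← Submodule.coe_smul,
          ← map_smul]
        rfl
      · rintro y z ⟨hy, hy0⟩ ⟨hz, hz0⟩
        exact ⟨I.add_mem hy hz, (map_add g ⟨y, hy⟩ ⟨z, hz⟩).trans (by rw [hy0, hz0, add_zero])⟩
    exact key.2
  let φ : I →ₗ[R] R ⧸ a ^ (n + k) := (a ^ (n + k)).mkQ ∘ₗ I.subtype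
  have hφ : LinearMap.ker φ ≤ LinearMap.ker ((powTorsion a E).subtype ∘ₗ g) := by
    rintro ⟨x, hx⟩ h
    have : x ∈ a ^ (n + k) := by simpa [φ, Ideal.Quotient.eq_zero_iff_mem] using h
    simp [hg x hx this]
  obtain ⟨h, hh⟩ := Module.Injective.out (Q := E) ((LinearMap.ker φ).liftQ φ le_rfl)
    (LinearMap.ker_eq_bot.mp (Submodule.ker_liftQ_eq_bot' _ _ rfl))
    ((LinearMap.ker φ).liftQ _ hφ)
  have hmem (x : R) : h ((a ^ (n + k)).mkQ x) ∈ powTorsion a E := by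
    refine ⟨n + k, fun r hr ↦ ?_⟩
    rw [← map_smul, ← map_smul, show (a ^ (n + k)).mkQ (r • x) = 0 by
      exact (Submodule.Quotient.mk_eq_zero _).mpr (Ideal.mul_mem_right x _ hr), map_zero]
  refine ⟨LinearMap.codRestrict _ (h ∘ₗ (a ^ (n + k)).mkQ) hmem, fun x hx ↦ ?_⟩
  ext
  exact hh ((LinearMap.ker φ).mkQ ⟨x, hx⟩)

theorem shortExact_of_exact {A B C : Type} [AddCommGroup A] [AddCommGroup B] [AddCommGroup C]
    [Module R A] [Module R B] [Module R C] (f : A →ₗ[R] B) (g : B →ₗ[R] C)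
    (hf : Function.Injective f) (hfg : Function.Exact f g) (hg : Function.Surjective g) :
    (ModuleCat.shortComplexOfCompEqZero f g hfg.linearMap_comp_eq_zero).ShortExact where
  exact := (ShortComplex.ShortExact.moduleCat_exact_iff_function_exact _).mpr hfg
  mono_f := (ModuleCat.mono_iff_injective _).mpr hf
  epi_g := (ModuleCat.epi_iff_surjective _).mpr hg

/-- The homomorphism `R ⧸ J ⟶ Y` sending `1` to an element `y` killed by `J`. -/
def quotHom (J : Ideal R) {Y : ModuleCat.{0} R} (y : Y) (hy : ∀ r ∈ J, r • y = 0) :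
    ModuleCat.of R (R ⧸ J) ⟶ Y :=
  ModuleCat.ofHom (Submodule.liftQ J (LinearMap.toSpanSingleton R Y y) hy)

theorem quotHom_one (J : Ideal R) {Y : ModuleCat.{0} R} (y : Y) (hy : ∀ r ∈ J, r • y = 0) :
    quotHom J y hy (1 : R ⧸ J) = y :=
  one_smul R y

theorem quot_hom_ext {J : Ideal R} {Y : ModuleCat.{0} R} {f g : ModuleCat.of R (R ⧸ J) ⟶ Y}
    (h : f (1 : R ⧸ J) = g (1 : R ⧸ J)) : f = g :=
  ModuleCat.hom_ext (Submodule.linearMap_qext _ (LinearMap.ext_ring h))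

theorem smul_hom_one {J : Ideal R} {Y : ModuleCat.{0} R} (f : ModuleCat.of R (R ⧸ J) ⟶ Y)
    {r : R} (hr : r ∈ J) : r • f (1 : R ⧸ J) = 0 := by
  rw [← LinearMap.map_smul_of_tower, ← map_zero f.hom]
  exact congrArg f.hom ((Submodule.Quotient.mk_eq_zero J).mpr (by simpa using hr))

theorem exists_injective_powTorsion [IsNoetherianRing R] (A : ModuleCat.{0} R)
    (hA : ∀ x : A, x ∈ powTorsion a A) : ∃ S : ShortComplex (ModuleCat.{0} R), S.ShortExact ∧
      S.X₁ = A ∧ Injective S.X₂ ∧ (∀ x : S.X₂, x ∈ powTorsion a S.X₂) ∧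
      ∀ x : S.X₃, x ∈ powTorsion a S.X₃ := by
  let E : ModuleCat.{0} R := Injective.under A
  let j : A ⟶ E := Injective.ι A
  have : Module.Injective R E :=
    have : Injective (ModuleCat.of R E) := inferInstanceAs (Injective (Injective.under A))
    Module.injective_module_of_injective_object R _
  have := powTorsion_injective a E
  let f : A →ₗ[R] powTorsion a E :=
    j.hom.codRestrict _ fun x ↦ map_mem_powTorsion j.hom (hA x)
  have hf : Function.Injective f := fun x y h ↦
    (ModuleCat.mono_iff_injective j).mp inferInstance (congrArg Subtype.val h)
  have htors (x : powTorsion a E) : x ∈ powTorsion a (powTorsion a _) := by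
    obtain ⟨n, hn⟩ := x.2
    exact ⟨n, fun r hr ↦ Subtype.ext (hn r hr)⟩
  refine ⟨_, shortExact_of_exact f f.range.mkQ hf f.exact_map_mkQ_range
    (Submodule.mkQ_surjective _), rfl, Module.injective_object_of_injective_module R _, htors, ?_⟩
  intro x
  obtain ⟨x, rfl⟩ := Submodule.mkQ_surjective _ x
  exact map_mem_powTorsion _ (htors x)

theorem exists_extPowMap_eq_zero [IsNoetherianRing R] (i : ℕ) : ∀ (A : ModuleCat.{0} R),
    (∀ x : A, x ∈ powTorsion a A) → ∀ (n : ℕ) (z : Ext (powQuot a n) A (i + 1)),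
    ∃ (m : ℕ) (h : n ≤ m), extPowMap a _ _ n m h z = 0 := by
  induction i with
  | zero =>
    intro A hA n z
    obtain ⟨S, hS, rfl, _, h₂, -⟩ := exists_injective_powTorsion a A hA
    obtain ⟨y, rfl⟩ := Ext.covariant_sequence_exact₁ _ hS z (Ext.eq_zero_of_injective _) rfl
    obtain ⟨y, rfl⟩ := (Ext.mk₀_bijective _ _).2 y
    obtain ⟨e, he⟩ := (ModuleCat.epi_iff_surjective S.g).mp hS.epi_g (y (1 : R ⧸ a ^ n))
    obtain ⟨m, hm⟩ := h₂ e
    refine ⟨max n m, le_max_left n m, ?_⟩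
    have key : powQuotMap a (le_max_left n m) ≫ y = quotHom (a ^ max n m) e
        (fun r hr ↦ hm r (Ideal.pow_le_pow_right (le_max_right n m) hr)) ≫ S.g := by
      apply quot_hom_ext
      exact (he.symm.trans (congrArg S.g (quotHom_one _ e _).symm))
    rw [extPowMap_apply, ← Ext.comp_assoc _ _ _ (zero_add 0) rfl (by lia), Ext.mk₀_comp_mk₀, key,
      ← Ext.mk₀_comp_mk₀, Ext.comp_assoc_of_second_deg_zero]
    refine (congrArg (fun t ↦ (Ext.mk₀ _).comp t (zero_add 1)) hS.comp_extClass).trans ?_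
    exact Ext.comp_zero _ _ _ _ _
  | succ i ih =>
    intro A hA n z
    obtain ⟨S, hS, rfl, _, -, h₃⟩ := exists_injective_powTorsion a A hA
    obtain ⟨y, rfl⟩ := Ext.covariant_sequence_exact₁ _ hS z (Ext.eq_zero_of_injective _) rfl
    obtain ⟨m, h, hm⟩ := ih _ h₃ n y
    refine ⟨m, h, ?_⟩
    rw [extPowMap_apply] at hm ⊢
    rw [← Ext.comp_assoc _ _ _ (zero_add _) rfl (by lia), hm, Ext.zero_comp]
end

section
variable {R : Type} [CommRing R] (a : Ideal R)

/-- The map induced on local cohomology by composition with an `Ext`-class. -/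
noncomputable def limExtMap {Y Z : ModuleCat.{0} R} {i d j : ℕ} (e : Ext Y Z d) (h : i + d = j) :
    LimExt a i Y →ₗ[R] LimExt a j Z :=
  Module.DirectLimit.map (fun n ↦ e.postcompOfLinear R (powQuot a n) h) fun n m hnm ↦
    LinearMap.ext fun z ↦ Ext.comp_assoc (Ext.mk₀ (powQuotMap a hnm)) z e (zero_add i) h (by lia)

theorem limExtMap_of {Y Z : ModuleCat.{0} R} {i d j : ℕ} (e : Ext Y Z d) (h : i + d = j) (n : ℕ)
    (z : Ext (powQuot a n) Y i) :
    limExtMap a e h (Module.DirectLimit.of R ℕ _ (extPowMap a Y i) n z) =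
      Module.DirectLimit.of R ℕ _ (extPowMap a Z j) n (z.comp e h) := by
  rw [limExtMap, Module.DirectLimit.map_apply_of]
  rfl

variable {S : ShortComplex (ModuleCat.{0} R)}

theorem limExtMap_g_bijective [IsNoetherianRing R] (hS : S.ShortExact)
    (hS₁ : ∀ x : S.X₁, x ∈ powTorsion a S.X₁) (i : ℕ) :
    Function.Bijective (limExtMap a (i := i + 1) (Ext.mk₀ S.g) (add_zero _)) := by
  constructor
  · rw [injective_iff_map_eq_zero]
    intro x hx
    obtain ⟨n, z, rfl⟩ := Module.DirectLimit.exists_of x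
    rw [limExtMap_of] at hx
    obtain ⟨m, hnm, hm⟩ := Module.DirectLimit.of.zero_exact hx
    rw [extPowMap_apply, ← Ext.comp_assoc_of_third_deg_zero] at hm
    obtain ⟨y, hy⟩ := Ext.covariant_sequence_exact₂ _ hS _ hm
    obtain ⟨k, hmk, hk⟩ := exists_extPowMap_eq_zero a i _ hS₁ m y
    rw [← Module.DirectLimit.of_f (hij := hnm), ← Module.DirectLimit.of_f (hij := hmk)]
    have : extPowMap a _ _ m k hmk (extPowMap a _ _ n m hnm z) = 0 := by
      rw [extPowMap_apply a hnm, ← hy, extPowMap_apply, ← Ext.comp_assoc_of_third_deg_zero,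
        ← extPowMap_apply, hk, Ext.zero_comp]
    rw [this, map_zero]
  · intro x
    obtain ⟨n, z, rfl⟩ := Module.DirectLimit.exists_of x
    obtain ⟨m, hnm, hm⟩ := exists_extPowMap_eq_zero a (i + 1) _ hS₁ n (z.comp hS.extClass rfl)
    rw [extPowMap_apply, ← Ext.comp_assoc _ _ _ (zero_add _) rfl (by lia)] at hm
    obtain ⟨y, hy⟩ := Ext.covariant_sequence_exact₃ _ hS _ rfl hm
    refine ⟨Module.DirectLimit.of R ℕ _ (extPowMap a _ _) m y, ?_⟩
    rw [limExtMap_of, hy, ← extPowMap_apply, Module.DirectLimit.of_f]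

theorem limExtMap_extClass_bijective (hS : S.ShortExact) (i : ℕ)
    (h₀ : ∀ n, Subsingleton (Ext (powQuot a n) S.X₂ i))
    (h₁ : ∀ n, Subsingleton (Ext (powQuot a n) S.X₂ (i + 1))) :
    Function.Bijective (limExtMap a (i := i) hS.extClass rfl) := by
  constructor
  · rw [injective_iff_map_eq_zero]
    intro x hx
    obtain ⟨n, z, rfl⟩ := Module.DirectLimit.exists_of x
    rw [limExtMap_of] at hx
    obtain ⟨m, hnm, hm⟩ := Module.DirectLimit.of.zero_exact hx
    rw [extPowMap_apply, ← Ext.comp_assoc _ _ _ (zero_add _) rfl (by lia)] at hm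
    obtain ⟨y, hy⟩ := Ext.covariant_sequence_exact₃ _ hS _ rfl hm
    rw [Subsingleton.elim y 0, Ext.zero_comp, ← extPowMap_apply] at hy
    rw [← Module.DirectLimit.of_f (hij := hnm), ← hy, map_zero]
  · intro x
    obtain ⟨n, z, rfl⟩ := Module.DirectLimit.exists_of x
    obtain ⟨y, rfl⟩ := Ext.covariant_sequence_exact₁ _ hS z (Subsingleton.elim _ _) rfl
    exact ⟨Module.DirectLimit.of R ℕ _ (extPowMap a _ _) n y, limExtMap_of a _ _ _ _⟩

/-- Evaluation at `1` of a homomorphism out of `R ⧸ J`, seen as an `Ext`-class of degree `0`. -/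
noncomputable def evalOne (J : Ideal R) (Y : ModuleCat.{0} R) :
    Ext (ModuleCat.of R (R ⧸ J)) Y 0 →ₗ[R] Y where
  toFun z := Ext.linearEquiv₀ (R := R) z (1 : R ⧸ J)
  map_add' x y := by rw [map_add]; rfl
  map_smul' r x := by rw [map_smul]; rfl

theorem evalOne_mk₀ {J : Ideal R} {Y : ModuleCat.{0} R} (f : ModuleCat.of R (R ⧸ J) ⟶ Y) :
    evalOne J Y (Ext.mk₀ f) = f (1 : R ⧸ J) := by
  obtain ⟨z, rfl⟩ := (Ext.linearEquiv₀ (R := R)).surjective f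
  rw [Ext.mk₀_linearEquiv₀_apply]
  rfl

theorem evalOne_injective (J : Ideal R) (Y : ModuleCat.{0} R) :
    Function.Injective (evalOne J Y) := fun x y h ↦ by
  obtain ⟨x, rfl⟩ := (Ext.mk₀_bijective _ _).2 x
  obtain ⟨y, rfl⟩ := (Ext.mk₀_bijective _ _).2 y
  rw [evalOne_mk₀, evalOne_mk₀] at h
  rw [quot_hom_ext h]

theorem smul_evalOne {J : Ideal R} {Y : ModuleCat.{0} R} (z : Ext (ModuleCat.of R (R ⧸ J)) Y 0)
    {r : R} (hr : r ∈ J) : r • evalOne J Y z = 0 :=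
  smul_hom_one (Ext.linearEquiv₀ (R := R) z) hr

theorem exists_evalOne_eq {J : Ideal R} {Y : ModuleCat.{0} R} (y : Y) (hy : ∀ r ∈ J, r • y = 0) :
    ∃ z, evalOne J Y z = y :=
  ⟨Ext.mk₀ (quotHom J y hy), (evalOne_mk₀ _).trans (quotHom_one J y hy)⟩

theorem evalOne_extPowMap {Y : ModuleCat.{0} R} {n m : ℕ} (h : n ≤ m)
    (z : Ext (powQuot a n) Y 0) : evalOne (a ^ m) Y (extPowMap a Y 0 n m h z) =
      evalOne (a ^ n) Y z := by
  obtain ⟨z, rfl⟩ := (Ext.mk₀_bijective _ _).2 z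
  rw [extPowMap_apply, Ext.mk₀_comp_mk₀, evalOne_mk₀, evalOne_mk₀]
  rfl

theorem exists_limExtZeroEquiv (Y : ModuleCat.{0} R) :
    Nonempty (LimExt a 0 Y ≃ₗ[R] powTorsion a Y) := by
  let f : LimExt a 0 Y →ₗ[R] Y := Module.DirectLimit.lift _ _ _ _ (fun n ↦ evalOne (a ^ n) Y)
    fun n m h z ↦ evalOne_extPowMap a h z
  have hf (n : ℕ) (z) : f (Module.DirectLimit.of R ℕ _ (extPowMap a Y 0) n z) =
    evalOne (a ^ n) Y z := Module.DirectLimit.lift_of _ _ _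
  have hfinj : Function.Injective f := by
    rw [injective_iff_map_eq_zero]
    intro x hx
    obtain ⟨n, z, rfl⟩ := Module.DirectLimit.exists_of x
    rw [hf] at hx
    rw [(injective_iff_map_eq_zero _).mp (evalOne_injective _ _) z hx, map_zero]
  have hrange : f.range = powTorsion a Y := by
    ext y
    constructor
    · rintro ⟨x, rfl⟩
      obtain ⟨n, z, rfl⟩ := Module.DirectLimit.exists_of x
      exact ⟨n, fun r hr ↦ by rw [hf]; exact smul_evalOne z hr⟩
    · rintro ⟨n, hn⟩
      obtain ⟨z, rfl⟩ := exists_evalOne_eq y hn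
      exact ⟨_, hf n z⟩
  exact ⟨LinearEquiv.ofInjective f hfinj ≪≫ₗ LinearEquiv.ofEq _ _ hrange⟩

/-- Every element of local cohomology is killed by a power of the ideal. -/
theorem mem_powTorsion_limExt (i : ℕ) (Y : ModuleCat.{0} R) (x : LimExt a i Y) :
    x ∈ powTorsion a (LimExt a i Y) := by
  obtain ⟨n, z, rfl⟩ := Module.DirectLimit.exists_of x
  refine ⟨n, fun r hr ↦ ?_⟩
  have h : r • 𝟙 (powQuot a n) = 0 := by
    refine quot_hom_ext ?_
    exact smul_hom_one (𝟙 (powQuot a n)) hr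
  have : r • z = 0 := by
    have := Ext.smul_comp (Ext.mk₀ (𝟙 (powQuot a n))) z (zero_add i) r
    rwa [Ext.mk₀_id_comp, ← Ext.mk₀_smul, h, Ext.mk₀_zero, Ext.zero_comp, eq_comm] at this
  rw [← map_smul, this, map_zero]

theorem ext_zero_subsingleton {J : Ideal R} {n : ℕ} (hJ : a ^ n ≤ J) (Y : ModuleCat.{0} R)
    (hY : powTorsion a Y = ⊥) : Subsingleton (Ext (ModuleCat.of R (R ⧸ J)) Y 0) := by
  refine subsingleton_of_forall_eq 0 fun z ↦ evalOne_injective _ _ ?_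
  rw [map_zero, ← Submodule.mem_bot R, ← hY]
  exact ⟨n, fun r hr ↦ smul_evalOne z (hJ hr)⟩

theorem powTorsion_quotient [IsNoetherianRing R] (M : Type*) [AddCommGroup M] [Module R M] :
    powTorsion a (M ⧸ powTorsion a M) = ⊥ := by
  rw [eq_bot_iff]
  intro x hx
  obtain ⟨x, rfl⟩ := Submodule.mkQ_surjective _ x
  simpa using mem_powTorsion_of_mkQ a hx

end

namespace WeaklyLaskerian

section
variable {R A B C : Type*} [CommRing R] [AddCommGroup A] [AddCommGroup B] [AddCommGroup C]
  [Module R A] [Module R B] [Module R C]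

theorem of_surjective (hA : WeaklyLaskerian R A) (f : A →ₗ[R] B) (hf : Function.Surjective f) :
    WeaklyLaskerian R B := fun N ↦ by
  have e := (N.mkQ ∘ₗ f).quotKerEquivOfSurjective (N.mkQ_surjective.comp hf)
  exact LinearEquiv.AssociatedPrimes.eq e ▸ hA _

theorem of_injective (hB : WeaklyLaskerian R B) (f : A →ₗ[R] B) (hf : Function.Injective f) :
    WeaklyLaskerian R A := fun N ↦ by
  refine (hB (N.map f)).subset (associatedPrimes.subset_of_injective
    (f := N.mapQ (N.map f) f (Submodule.le_comap_map f N)) ?_)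
  rw [← LinearMap.ker_eq_bot, Submodule.ker_mapQ, Submodule.comap_map_eq_of_injective hf,
    Submodule.mkQ_map_self]

theorem of_linearEquiv (hA : WeaklyLaskerian R A) (e : A ≃ₗ[R] B) : WeaklyLaskerian R B :=
  hA.of_surjective e.toLinearMap e.surjective

theorem finite_associatedPrimes (hA : WeaklyLaskerian R A) : (associatedPrimes R A).Finite :=
  LinearEquiv.AssociatedPrimes.eq (Submodule.quotEquivOfEqBot (⊥ : Submodule R A) rfl) ▸ hA ⊥

theorem of_subsingleton [Subsingleton A] : WeaklyLaskerian R A := fun N ↦ by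
  have : Subsingleton (A ⧸ N) := N.mkQ_surjective.subsingleton
  simp [associatedPrimes.eq_empty_of_subsingleton]

theorem of_finite [IsNoetherianRing R] [Module.Finite R A] : WeaklyLaskerian R A :=
  fun _ ↦ associatedPrimes.finite _ _

theorem of_exact (hA : WeaklyLaskerian R A) (hC : WeaklyLaskerian R C) (f : A →ₗ[R] B)
    (g : B →ₗ[R] C) (hfg : Function.Exact f g) : WeaklyLaskerian R B := fun N ↦ by
  let f' := N.mkQ ∘ₗ f
  let g' := N.mapQ (N.map g) g (Submodule.le_comap_map g N)
  have hexact : Function.Exact f'.range.subtype g' := by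
    intro x
    obtain ⟨b, rfl⟩ := N.mkQ_surjective x
    constructor
    · intro h
      obtain ⟨n, hn, hgn⟩ := (Submodule.Quotient.mk_eq_zero _).mp h
      obtain ⟨y, hy⟩ := (hfg (b - n)).mp (by rw [map_sub, hgn, sub_self])
      refine ⟨⟨f' y, y, rfl⟩, ?_⟩
      change N.mkQ (f y) = N.mkQ b
      rw [hy, map_sub, (Submodule.Quotient.mk_eq_zero N).mpr hn |> (show N.mkQ n = 0 from ·),
        sub_zero]
    · rintro ⟨⟨_, y, rfl⟩, h⟩
      rw [← h]
      change (N.map g).mkQ (g (f y)) = 0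
      rw [hfg.apply_apply_eq_zero, map_zero]
  exact ((hA.of_surjective f'.rangeRestrict
    f'.surjective_rangeRestrict).finite_associatedPrimes.union (hC _)).subset
      (associatedPrimes.subset_union_of_exact f'.range.injective_subtype hexact)

theorem pi_fin (hA : WeaklyLaskerian R A) (n : ℕ) : WeaklyLaskerian R (Fin n → A) := by
  induction n with
  | zero => exact of_subsingleton
  | succ n ih =>
    refine of_exact hA ih (LinearMap.single R (fun _ : Fin (n + 1) ↦ A) 0)
      (LinearMap.funLeft R A Fin.succ) fun x ↦ ⟨fun h ↦ ⟨x 0, ?_⟩, ?_⟩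
    · ext k
      refine Fin.cases ?_ (fun k ↦ ?_) k
      · simp
      · simpa using (congrFun h k).symm
    · rintro ⟨y, rfl⟩
      ext k
      simp [LinearMap.funLeft_apply]

end

section
variable {R : Type} [CommRing R]

theorem ext_zero {X Y : ModuleCat.{0} R} [Module.Finite R X] (hY : WeaklyLaskerian R Y) :
    WeaklyLaskerian R (Ext X Y 0) := by
  obtain ⟨n, f, hf⟩ := Module.Finite.exists_fin' R X
  refine (hY.pi_fin n).of_injective
    ((LinearMap.pi fun k ↦ LinearMap.applyₗ (f (Pi.single k 1))) ∘ₗ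
      (Ext.linearEquiv₀ (R := R) ≪≫ₗ ModuleCat.homLinearEquiv (S := R)).toLinearMap) ?_
  rw [LinearMap.coe_comp]
  refine Function.Injective.comp (fun g h hgh ↦ ?_) (LinearEquiv.injective _)
  rw [← LinearMap.cancel_right hf]
  refine LinearMap.pi_ext' fun k ↦ LinearMap.ext_ring ?_
  exact congrFun hgh k

theorem ext [IsNoetherianRing R] {Y : ModuleCat.{0} R} (hY : WeaklyLaskerian R Y) (i : ℕ) :
    ∀ (X : ModuleCat.{0} R) [Module.Finite R X], WeaklyLaskerian R (Ext X Y i) := by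
  induction i with
  | zero => exact fun X _ ↦ ext_zero hY
  | succ i ih =>
    intro X _
    obtain ⟨P, _, _, _, _, f, hf⟩ := Module.exists_finite_presentation R X
    have exac := LinearMap.shortExact_shortComplexKer hf
    exact (ih _).of_surjective (exac.extClass.precompOfLinear R Y (add_comm 1 i))
      (precomp_extClass_surjective_of_projective_X₂ Y exac i)

variable {S : ShortComplex (ModuleCat.{0} R)} {X : ModuleCat.{0} R}

theorem ext_X₁_zero (hS : S.ShortExact) (h : WeaklyLaskerian R (Ext X S.X₂ 0)) :
    WeaklyLaskerian R (Ext X S.X₁ 0) :=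
  h.of_injective ((Ext.mk₀ S.f).postcompOfLinear R X (add_zero 0))
    (have := hS.mono_f; Ext.postcomp_mk₀_injective_of_mono X S.f)

theorem ext_X₁ (hS : S.ShortExact) {i : ℕ} (h₃ : WeaklyLaskerian R (Ext X S.X₃ i))
    (h₂ : WeaklyLaskerian R (Ext X S.X₂ (i + 1))) : WeaklyLaskerian R (Ext X S.X₁ (i + 1)) := by
  refine h₃.of_exact h₂ (hS.extClass.postcompOfLinear R X rfl)
    ((Ext.mk₀ S.f).postcompOfLinear R X (add_zero _)) fun x ↦
      ⟨fun h ↦ Ext.covariant_sequence_exact₁ X hS x h rfl, ?_⟩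
  rintro ⟨y, rfl⟩
  change (y.comp hS.extClass rfl).comp (Ext.mk₀ S.f) (add_zero _) = 0
  rw [Ext.comp_assoc_of_third_deg_zero, hS.extClass_comp, Ext.comp_zero]

theorem ext_X₃ (hS : S.ShortExact) {i : ℕ} (h₂ : WeaklyLaskerian R (Ext X S.X₂ i))
    (h₁ : WeaklyLaskerian R (Ext X S.X₁ (i + 1))) : WeaklyLaskerian R (Ext X S.X₃ i) := by
  refine h₂.of_exact h₁ ((Ext.mk₀ S.g).postcompOfLinear R X (add_zero _))
    (hS.extClass.postcompOfLinear R X rfl) fun x ↦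
      ⟨fun h ↦ Ext.covariant_sequence_exact₃ X hS x rfl h, ?_⟩
  rintro ⟨y, rfl⟩
  change (y.comp (Ext.mk₀ S.g) (add_zero _)).comp hS.extClass rfl = 0
  rw [Ext.comp_assoc_of_second_deg_zero, hS.comp_extClass, Ext.comp_zero]

theorem ext_congr {Y Z : ModuleCat.{0} R} {i : ℕ} (h : WeaklyLaskerian R (Ext X Y i))
    (e : Y ≃ₗ[R] Z) : WeaklyLaskerian R (Ext X Z i) := by
  refine h.of_surjective ((Ext.mk₀ e.toModuleIso.hom).postcompOfLinear R X (add_zero i)) fun z ↦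
    ⟨z.comp (Ext.mk₀ e.toModuleIso.inv) (add_zero i), ?_⟩
  change (z.comp (Ext.mk₀ e.toModuleIso.inv) (add_zero i)).comp (Ext.mk₀ e.toModuleIso.hom)
    (add_zero i) = z
  rw [Ext.comp_assoc_of_third_deg_zero, Ext.mk₀_comp_mk₀, Iso.inv_hom_id, Ext.comp_mk₀_id]

end
end WeaklyLaskerian

section
variable {R : Type} [CommRing R] (a : Ideal R)

theorem shortExact_powTorsion (M : ModuleCat.{0} R) :
    (ModuleCat.shortComplexOfCompEqZero (powTorsion a M).subtype (powTorsion a M).mkQ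
      (LinearMap.exact_subtype_mkQ _).linearMap_comp_eq_zero).ShortExact :=
  shortExact_of_exact _ _ (Submodule.injective_subtype _) (LinearMap.exact_subtype_mkQ _)
    (Submodule.mkQ_surjective _)

variable [IsNoetherianRing R]

theorem ext_quotient_powTorsion_subsingleton (E : ModuleCat.{0} R) [Injective E]
    (X : ModuleCat.{0} R) (i : ℕ) :
    Subsingleton (Ext X (ModuleCat.of R (E ⧸ powTorsion a E)) (i + 1)) := by
  have : Module.Injective R E := Module.injective_module_of_injective_object R E
  have := powTorsion_injective a E
  have : Injective (ModuleCat.of R (powTorsion a E)) :=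
    Module.injective_object_of_injective_module R _
  refine subsingleton_of_forall_eq 0 fun z ↦ ?_
  obtain ⟨y, rfl⟩ := Ext.covariant_sequence_exact₃ X (shortExact_powTorsion a E) z rfl
    (Ext.eq_zero_of_injective (I := ModuleCat.of R (powTorsion a E)) _)
  rw [Ext.eq_zero_of_injective (I := E) y, Ext.zero_comp]

/-- A module without `a`-torsion embeds in a module `S.X₂` against which all `R ⧸ J`, for `J`
containing a power of `a`, have vanishing `Ext`. -/
theorem exists_shortExact_ext_subsingleton (L : ModuleCat.{0} R) (hL : powTorsion a L = ⊥) :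
    ∃ S : ShortComplex (ModuleCat.{0} R), S.ShortExact ∧ S.X₁ = L ∧
      ∀ (J : Ideal R) (n : ℕ), a ^ n ≤ J → ∀ i,
        Subsingleton (Ext (ModuleCat.of R (R ⧸ J)) S.X₂ i) := by
  let E : ModuleCat.{0} R := Injective.under L
  let ι : L →ₗ[R] E := (Injective.ι L).hom
  have hι : Function.Injective ι := (ModuleCat.mono_iff_injective _).mp inferInstance
  let f : L →ₗ[R] E ⧸ powTorsion a E := (powTorsion a E).mkQ ∘ₗ ι
  have hf : Function.Injective f := by
    rw [injective_iff_map_eq_zero]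
    intro x hx
    obtain ⟨n, hn⟩ := (Submodule.Quotient.mk_eq_zero _).mp hx
    rw [← Submodule.mem_bot R, ← hL]
    exact ⟨n, fun r hr ↦ hι (by rw [map_smul, hn r hr, map_zero])⟩
  refine ⟨_, shortExact_of_exact f f.range.mkQ hf (LinearMap.exact_map_mkQ_range f)
    (Submodule.mkQ_surjective _), rfl, fun J n hJ i ↦ ?_⟩
  cases i with
  | zero => exact ext_zero_subsingleton a hJ _ (powTorsion_quotient a E)
  | succ i => exact ext_quotient_powTorsion_subsingleton a E _ i

theorem WeaklyLaskerian.ext_powTorsion {M : ModuleCat.{0} R}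
    (hM : ∀ i ≤ 1, WeaklyLaskerian R (Ext (ModuleCat.of R (R ⧸ a)) M i)) (j : ℕ) (hj : j ≤ 1) :
    WeaklyLaskerian R (Ext (ModuleCat.of R (R ⧸ a)) (ModuleCat.of R (powTorsion a M)) j) := by
  have hS := shortExact_powTorsion a M
  cases j with
  | zero => exact ext_X₁_zero hS (hM 0 hj)
  | succ j =>
    obtain rfl : j = 0 := by lia
    have := ext_zero_subsingleton a (pow_one a).le (ModuleCat.of R (M ⧸ powTorsion a M))
      (powTorsion_quotient a M)
    exact ext_X₁ hS (of_subsingleton (A := Ext _ (ModuleCat.of R (M ⧸ powTorsion a M)) 0))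
      (hM 1 hj)

/-- If the `Ext`-modules of `R ⧸ a` with values in `M` and in the lower local cohomology modules of
`M` are weakly Laskerian, then so are the first two with values in the next local cohomology. -/
theorem WeaklyLaskerian.ext_limExt (t : ℕ) : ∀ (M : ModuleCat.{0} R),
    (∀ i ≤ t + 1, WeaklyLaskerian R (Ext (ModuleCat.of R (R ⧸ a)) M i)) →
    (∀ i < t, ∀ j, WeaklyLaskerian R
      (Ext (ModuleCat.of R (R ⧸ a)) (ModuleCat.of R (LimExt a i M)) j)) →
    ∀ j ≤ 1, WeaklyLaskerian R
      (Ext (ModuleCat.of R (R ⧸ a)) (ModuleCat.of R (LimExt a t M)) j) := by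
  induction t with
  | zero =>
    intro M hM _ j hj
    obtain ⟨e⟩ := exists_limExtZeroEquiv a M
    exact ext_congr (Y := ModuleCat.of R (powTorsion a M)) (Z := ModuleCat.of R (LimExt a 0 M))
      (ext_powTorsion a hM j hj) e.symm
  | succ t ih =>
    intro M hM hlim j hj
    obtain ⟨e₀⟩ := exists_limExtZeroEquiv a M
    have hS₁ := shortExact_powTorsion a M
    obtain ⟨L, hL⟩ : ∃ L, L = ModuleCat.of R (M ⧸ powTorsion a M) := ⟨_, rfl⟩
    have hLM (i : ℕ) : Nonempty (LimExt a (i + 1) M ≃ₗ[R] LimExt a (i + 1) L) :=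
      hL ▸ ⟨LinearEquiv.ofBijective _ (limExtMap_g_bijective a hS₁
        (fun ⟨x, n, hn⟩ ↦ ⟨n, fun r hr ↦ Subtype.ext (hn r hr)⟩) i)⟩
    have hLext : ∀ i ≤ t + 2, WeaklyLaskerian R (Ext (ModuleCat.of R (R ⧸ a)) L i) := fun i hi ↦
      hL ▸ ext_X₃ hS₁ (hM i hi) (ext_congr (Y := ModuleCat.of R (LimExt a 0 M))
        (Z := ModuleCat.of R (powTorsion a M)) (hlim 0 (by lia) (i + 1)) e₀)
    obtain ⟨S, hS, hSL, hvan⟩ := exists_shortExact_ext_subsingleton a L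
      (hL ▸ powTorsion_quotient a M)
    clear hL
    subst hSL
    have hNM (i : ℕ) : Nonempty (LimExt a i S.X₃ ≃ₗ[R] LimExt a (i + 1) M) := by
      obtain ⟨e⟩ := hLM i
      exact ⟨LinearEquiv.ofBijective _ (limExtMap_extClass_bijective a hS i
        (fun n ↦ hvan _ n le_rfl i) fun n ↦ hvan _ n le_rfl (i + 1)) ≪≫ₗ e.symm⟩
    obtain ⟨e⟩ := hNM t
    refine ext_congr (Y := ModuleCat.of R (LimExt a t S.X₃))
      (Z := ModuleCat.of R (LimExt a (t + 1) M)) (ih S.X₃ (fun i hi ↦ ?_) (fun i hi j ↦ ?_) j hj) e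
    · have := hvan a 1 (pow_one a).le i
      exact ext_X₃ hS of_subsingleton (hLext (i + 1) (by lia))
    · obtain ⟨e⟩ := hNM i
      exact ext_congr (Y := ModuleCat.of R (LimExt a (i + 1) M))
        (Z := ModuleCat.of R (LimExt a i S.X₃)) (hlim (i + 1) (by lia) j) e.symm

theorem associatedPrimes_subset_ext_zero (H : ModuleCat.{0} R)
    (hH : ∀ x : H, x ∈ powTorsion a H) :
    associatedPrimes R H ⊆ associatedPrimes R (Ext (ModuleCat.of R (R ⧸ a)) H 0) := by
  intro p hp
  obtain ⟨hprime, x, rfl⟩ := isAssociatedPrime_iff.mp hp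
  obtain ⟨n, hn⟩ := hH x
  have hx : ∀ r ∈ a, r • x = 0 := fun r hr ↦ Submodule.mem_colon_singleton.mp
    (hprime.mem_of_pow_mem n (Submodule.mem_colon_singleton.mpr (hn _ (Ideal.pow_mem_pow hr n))))
  obtain ⟨z, rfl⟩ := exists_evalOne_eq x hx
  refine isAssociatedPrime_iff.mpr ⟨hprime, z, ?_⟩
  ext r
  simp only [Submodule.mem_colon_singleton, Submodule.mem_bot]
  rw [← map_smul, map_eq_zero_iff _ (evalOne_injective a H)]

end

/-- If `M` is weakly Laskerian and `H_a^i(M)` is `a`-cofinite for all `i < t`,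
then `Ass H_a^t(M)` and `Ass Ext^1(R/a, H_a^t(M))` are finite. -/
theorem associatedPrimes_finite_of_cofinite_below
    {R : Type} [CommRing R] [IsNoetherianRing R] (a : Ideal R)
    (M : Type) [AddCommGroup M] [Module R M] (hM : WeaklyLaskerian R M) (t : ℕ)
    (hc : ∀ i < t, IsCofinite a ((localCohomology a i).obj (ModuleCat.of R M))) :
    (associatedPrimes R ((localCohomology a t).obj (ModuleCat.of R M))).Finite ∧
      (associatedPrimes R
        (extMod a 1 ((localCohomology a t).obj (ModuleCat.of R M)))).Finite := by
  obtain ⟨e⟩ := exists_localCohomologyEquiv a (ModuleCat.of R M) t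
  have hlim (i : ℕ) (hi : i < t) (j : ℕ) : WeaklyLaskerian R (Abelian.Ext
      (ModuleCat.of R (R ⧸ a)) (ModuleCat.of R (LimExt a i (ModuleCat.of R M))) j) := by
    obtain ⟨e⟩ := exists_localCohomologyEquiv a (ModuleCat.of R M) i
    have := (hc i hi).2 j
    have hH : WeaklyLaskerian R (extMod a j ((localCohomology a i).obj (ModuleCat.of R M))) :=
      .of_finite
    exact (hH.of_linearEquiv (extEquiv _ _ j)).ext_congr
      (Z := ModuleCat.of R (LimExt a i (ModuleCat.of R M))) e
  have hext := WeaklyLaskerian.ext_limExt a t (ModuleCat.of R M)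
    (fun i _ ↦ WeaklyLaskerian.ext (Y := ModuleCat.of R M) hM i _) hlim
  constructor
  · rw [LinearEquiv.AssociatedPrimes.eq e]
    exact (hext 0 zero_le_one).finite_associatedPrimes.subset (associatedPrimes_subset_ext_zero a
      (ModuleCat.of R (LimExt a t (ModuleCat.of R M))) (mem_powTorsion_limExt a t _))
  · exact (((hext 1 le_rfl).ext_congr (Z := (localCohomology a t).obj (ModuleCat.of R M))
      e.symm).of_linearEquiv (extEquiv _ _ 1).symm).finite_associatedPrimes
end

section
/- Let a be an ideal of R and M a finitely generated R-module. If t is an integer such that Supp_R(H_a^i(M)) is finite for all i < t, then Ass_R(H_a^t(M)) is finite. -/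
open CategoryTheory

namespace ChainComplex

universe v u
variable {R : Type u} [Ring R] (K : ChainComplex (ModuleCat.{v} R)ᵒᵖ ℕ) (n : ℕ)

lemma pOpcycles_unop_injective : Function.Injective (K.pOpcycles n).unop :=
  (ModuleCat.mono_iff_injective _).mp inferInstance

lemma homologyι_unop_surjective : Function.Surjective (K.homologyι n).unop :=
  (ModuleCat.epi_iff_surjective _).mp inferInstance

lemma exists_pOpcycles_unop_eq (z : (K.X n).unop) (hz : (K.d (n + 1) n).unop z = 0) :
    ∃ c : (K.opcycles n).unop, (K.pOpcycles n).unop c = z := by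
  have h := (ShortComplex.exact_of_g_is_cokernel (.mk _ _ (K.d_pOpcycles (n + 1) n))
    (K.opcyclesIsCokernel (n + 1) n (by simp))).unop
  exact (ShortComplex.moduleCat_exact_iff _).mp h z hz

lemma homologyι_unop_eq_zero_iff (c : (K.opcycles n).unop) (p : ℕ)
    (hp : (ComplexShape.down ℕ).next n = p) :
    (K.homologyι n).unop c = 0 ↔ ∃ g : (K.X p).unop, (K.fromOpcycles n p).unop g = c := by
  have h := (ShortComplex.exact_of_f_is_kernel (.mk _ _ (K.homologyι_comp_fromOpcycles n p))
    (K.homologyIsKernel n p hp)).unop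
  refine ⟨fun hc ↦ (ShortComplex.moduleCat_exact_iff _).mp h c hc, ?_⟩
  rintro ⟨g, rfl⟩
  have := congr($(K.homologyι_comp_fromOpcycles n p).unop g)
  exact this

end ChainComplex

namespace CategoryTheory.ProjectiveResolution

universe w v u t
open Abelian

section
variable {C : Type u} [Category.{v} C] [Abelian C] [HasExt.{w} C]
  {X Y : C} (P : ProjectiveResolution X)

lemma extMk_eq_zero_iff_of_zero (f : P.complex.X 0 ⟶ Y) (m : ℕ) (hm : 0 + 1 = m)
    (hf : P.complex.d m 0 ≫ f = 0) : P.extMk f m hm hf = 0 ↔ f = 0 := by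
  refine ⟨fun h ↦ ?_, fun h ↦ by subst h; simp⟩
  rw [← P.extEquivCohomologyClass.apply_eq_iff_eq, extEquivCohomologyClass_extMk,
    extEquivCohomologyClass_zero, CochainComplex.HomComplex.CohomologyClass.mk_eq_zero_iff,
    CochainComplex.HomComplex.Cocycle.toSingleMk_mem_coboundaries_iff _ _ _ _ _ 1 (by lia)] at h
  obtain ⟨g, hg⟩ := h
  have : P.cochainComplex.d (-((0 : ℕ) : ℤ)) 1 = 0 :=
    (P.cochainComplex.isZero_of_isStrictlyLE 0 1 (by lia)).eq_of_tgt _ _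
  rw [this, Limits.zero_comp] at hg
  simpa using hg.symm

lemma extMk_eq_zero_iff_exists_next {n : ℕ} (f : P.complex.X n ⟶ Y) (m : ℕ) (hm : n + 1 = m)
    (hf : P.complex.d m n ≫ f = 0) (p : ℕ) (hp : (ComplexShape.down ℕ).next n = p) :
    P.extMk f m hm hf = 0 ↔ ∃ g : P.complex.X p ⟶ Y, P.complex.d n p ≫ g = f := by
  subst hp
  cases n with
  | zero =>
    rw [extMk_eq_zero_iff_of_zero]
    simp [eq_comm]
  | succ n => exact P.extMk_eq_zero_iff f m hm hf _ (by simp)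

end

section
variable {C : Type u} [Category.{v} C] [Abelian C] [EnoughProjectives C]
  {D : Type*} [Category* D] [Abelian D] {X X' : C} (P : ProjectiveResolution X)
  (P' : ProjectiveResolution X') (F : C ⥤ D) [F.Additive] (n : ℕ)

/-- The `n`-th left derived functor is a subobject of the opcycles of the image of a
projective resolution. -/
noncomputable def leftDerivedToOpcycles :
    (F.leftDerived n).obj X ⟶ ((F.mapHomologicalComplex _).obj P.complex).opcycles n :=
  (P.isoLeftDerivedObj F n).hom ≫ HomologicalComplex.homologyι _ n

instance : Mono (P.leftDerivedToOpcycles F n) := by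
  unfold leftDerivedToOpcycles
  exact mono_comp' inferInstance
    (inferInstanceAs (Mono (((F.mapHomologicalComplex _).obj P.complex).homologyι n)))

lemma leftDerivedToOpcycles_naturality (f : X ⟶ X') (φ : Hom P P' f) :
    (F.leftDerived n).map f ≫ P'.leftDerivedToOpcycles F n =
      P.leftDerivedToOpcycles F n ≫
        HomologicalComplex.opcyclesMap ((F.mapHomologicalComplex _).map φ.hom) n := by
  have hderived := isoLeftDerivedObj_hom_naturality f P P' φ.hom
    (by simpa using φ.hom_f_zero_comp_π_f_zero) F n
  have hopcycles := HomologicalComplex.homologyι_naturality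
    ((F.mapHomologicalComplex (ComplexShape.down ℕ)).map φ.hom) n
  refine (Category.assoc _ _ _).symm.trans ?_
  refine (congrArg (· ≫ HomologicalComplex.homologyι _ n) hderived).trans ?_
  refine (Category.assoc _ _ _).trans ?_
  refine (congrArg ((P.isoLeftDerivedObj F n).hom ≫ ·) hopcycles).trans ?_
  exact (Category.assoc _ _ _).symm

end

section
variable {R : Type t} [CommRing R] {C : Type u} [Category.{v} C] [Abelian C] [Linear R C]
  [EnoughProjectives C] [HasExt.{w} C] {X X' : C} (P : ProjectiveResolution X)
  (P' : ProjectiveResolution X') (Y : C) (n : ℕ)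

variable (R) in
/-- The complex `Hom(P, Y)`, seen as a chain complex in the opposite category of modules. -/
noncomputable abbrev opLinearYonedaComplex : ChainComplex (ModuleCat.{v} R)ᵒᵖ ℕ :=
  (((linearYoneda R C).obj Y).rightOp.mapHomologicalComplex _).obj P.complex

variable (R) in
/-- The cocycle `P.complex.X n ⟶ Y` underlying an element of the opcycles. -/
noncomputable def cocycleHom :
    ((P.opLinearYonedaComplex R Y).opcycles n).unop →ₗ[R] (P.complex.X n ⟶ Y) :=
  ((P.opLinearYonedaComplex R Y).pOpcycles n).unop.hom

omit [EnoughProjectives C] [HasExt.{w} C] in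
variable {Y n} in
lemma d_comp_cocycleHom (c : ((P.opLinearYonedaComplex R Y).opcycles n).unop) :
    P.complex.d (n + 1) n ≫ P.cocycleHom R Y n c = 0 :=
  congr($((P.opLinearYonedaComplex R Y).d_pOpcycles (n + 1) n).unop c)

variable (R) in
/-- The class of a cocycle in `Ext`, as a linear map. -/
noncomputable def opcyclesToExt :
    ((P.opLinearYonedaComplex R Y).opcycles n).unop →ₗ[R] Abelian.Ext.{w} X Y n where
  toFun c := P.extMk (P.cocycleHom R Y n c) (n + 1) rfl (P.d_comp_cocycleHom c)
  map_add' c c' := by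
    simp only [map_add]
    rw [add_extMk]
  map_smul' r c := by
    simp only [map_smul, RingHom.id_apply]
    rw [Ext.smul_eq_comp_mk₀, extMk_comp_mk₀]
    simp

omit [EnoughProjectives C] in
lemma opcyclesToExt_surjective : Function.Surjective (P.opcyclesToExt R Y n) := by
  intro α
  obtain ⟨f, hf, rfl⟩ := P.extMk_surjective α (n + 1) rfl
  obtain ⟨c, hc⟩ := (P.opLinearYonedaComplex R Y).exists_pOpcycles_unop_eq n f hf
  refine ⟨c, ?_⟩
  subst hc
  rfl

omit [EnoughProjectives C] in
lemma opcyclesToExt_eq_zero_iff (c : ((P.opLinearYonedaComplex R Y).opcycles n).unop) :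
    P.opcyclesToExt R Y n c = 0 ↔
      ((P.opLinearYonedaComplex R Y).homologyι n).unop c = 0 := by
  rw [ChainComplex.homologyι_unop_eq_zero_iff _ _ _ _ rfl]
  refine (P.extMk_eq_zero_iff_exists_next _ _ rfl (P.d_comp_cocycleHom c) _ rfl).trans
    (exists_congr fun g ↦ ?_)
  rw [← ((P.opLinearYonedaComplex R Y).pOpcycles_unop_injective n).eq_iff]
  have := congr($((P.opLinearYonedaComplex R Y).p_fromOpcycles n _).unop g)
  exact Eq.congr_left this.symm

variable (R) in
/-- The class of a cocycle in the derived functor version of `Ext`, as a linear map. -/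
noncomputable def opcyclesToLeftDerived :
    ((P.opLinearYonedaComplex R Y).opcycles n).unop →ₗ[R]
      ((_root_.Ext R C n).obj (.op X)).obj Y :=
  (P.leftDerivedToOpcycles ((linearYoneda R C).obj Y).rightOp n).unop.hom

omit [HasExt.{w} C] in
lemma opcyclesToLeftDerived_surjective :
    Function.Surjective (P.opcyclesToLeftDerived R Y n) :=
  (ModuleCat.epi_iff_surjective _).mp (unop_epi_of_mono
    (P.leftDerivedToOpcycles ((linearYoneda R C).obj Y).rightOp n))

omit [HasExt.{w} C] in
lemma opcyclesToLeftDerived_eq_zero_iff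
    (c : ((P.opLinearYonedaComplex R Y).opcycles n).unop) :
    P.opcyclesToLeftDerived R Y n c = 0 ↔
      ((P.opLinearYonedaComplex R Y).homologyι n).unop c = 0 := by
  have : Function.Injective
      (P.isoLeftDerivedObj ((linearYoneda R C).obj Y).rightOp n).hom.unop :=
    (ModuleCat.mono_iff_injective _).mp inferInstance
  exact map_eq_zero_iff (P.isoLeftDerivedObj ((linearYoneda R C).obj Y).rightOp n).hom.unop.hom this

variable (R) in
/-- The derived functor version of `Ext` agrees with the derived category version. -/
noncomputable def extLinearEquiv :
    ((_root_.Ext R C n).obj (.op X)).obj Y ≃ₗ[R] Abelian.Ext.{w} X Y n :=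
  ((P.opcyclesToLeftDerived R Y n).quotKerEquivOfSurjective
    (P.opcyclesToLeftDerived_surjective Y n)).symm ≪≫ₗ
  Submodule.quotEquivOfEq _ _ (by
    ext c
    rw [LinearMap.mem_ker, LinearMap.mem_ker, opcyclesToLeftDerived_eq_zero_iff,
      opcyclesToExt_eq_zero_iff]) ≪≫ₗ
  (P.opcyclesToExt R Y n).quotKerEquivOfSurjective (P.opcyclesToExt_surjective Y n)

lemma extLinearEquiv_opcyclesToLeftDerived
    (c : ((P.opLinearYonedaComplex R Y).opcycles n).unop) :
    P.extLinearEquiv R Y n (P.opcyclesToLeftDerived R Y n c) = P.opcyclesToExt R Y n c := by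
  have : ((P.opcyclesToLeftDerived R Y n).quotKerEquivOfSurjective
      (P.opcyclesToLeftDerived_surjective Y n)).symm (P.opcyclesToLeftDerived R Y n c) =
      Submodule.Quotient.mk c := by
    rw [LinearEquiv.symm_apply_eq]
    rfl
  simp only [extLinearEquiv, LinearEquiv.trans_apply, this]
  rfl

lemma extLinearEquiv_naturality (f : X ⟶ X') (x : ((_root_.Ext R C n).obj (.op X')).obj Y) :
    P.extLinearEquiv R Y n ((((_root_.Ext R C n).map f.op).app Y).hom x) =
      (Ext.mk₀ f).comp (P'.extLinearEquiv R Y n x) (zero_add n) := by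
  obtain ⟨c, rfl⟩ := P'.opcyclesToLeftDerived_surjective Y n x
  let F := ((linearYoneda R C).obj Y).rightOp
  let φ : Hom P P' f := ⟨lift f P P', by simpa using lift_commutes_zero f P P'⟩
  let ψ := (F.mapHomologicalComplex (ComplexShape.down ℕ)).map φ.hom
  have h : (((_root_.Ext R C n).map f.op).app Y).hom (P'.opcyclesToLeftDerived R Y n c) =
      P.opcyclesToLeftDerived R Y n ((HomologicalComplex.opcyclesMap ψ n).unop c) :=
    congr($(leftDerivedToOpcycles_naturality P P' F n f φ).unop c)
  rw [h, extLinearEquiv_opcyclesToLeftDerived, extLinearEquiv_opcyclesToLeftDerived]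
  refine Eq.trans ?_ (mk₀_comp_extMk _ _ rfl (P'.d_comp_cocycleHom c) φ).symm
  have hcocycle : P.cocycleHom R Y n ((HomologicalComplex.opcyclesMap ψ n).unop c) =
      φ.hom.f n ≫ P'.cocycleHom R Y n c :=
    congr($(HomologicalComplex.p_opcyclesMap ψ n).unop c)
  simp only [opcyclesToExt, LinearMap.coe_mk, AddHom.coe_mk, hcocycle]

end
end CategoryTheory.ProjectiveResolution

section AssociatedAtPrime

variable {R : Type*} [CommRing R] {A B C : Type*} [AddCommGroup A] [Module R A]
  [AddCommGroup B] [Module R B] [AddCommGroup C] [Module R C]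

/-- The annihilator of `x` becomes the maximal ideal after localizing at `p`. -/
def IsLocallyAssociatedTo (p : PrimeSpectrum R) (x : A) : Prop :=
  (∀ s ∉ p.asIdeal, s • x ≠ 0) ∧ ∀ q ∈ p.asIdeal, ∃ s ∉ p.asIdeal, s • q • x = 0

variable {p : PrimeSpectrum R}

lemma mem_associatedPrimes_iff_exists_isLocallyAssociatedTo [IsNoetherianRing R] :
    p.asIdeal ∈ associatedPrimes R A ↔ ∃ x : A, IsLocallyAssociatedTo p x := by
  rw [AssociatedPrimes.mem_iff, isAssociatedPrime_iff]
  constructor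
  · rintro ⟨-, x, hx⟩
    have key (r : R) : r ∈ p.asIdeal ↔ r • x = 0 := by
      rw [hx, Submodule.mem_colon_singleton, Submodule.mem_bot]
    exact ⟨x, fun s hs h ↦ hs ((key s).2 h), fun q hq ↦
      ⟨1, p.asIdeal.ne_top_iff_one.1 p.2.ne_top, by rw [(key q).1 hq, smul_zero]⟩⟩
  · rintro ⟨x, hx, hx'⟩
    obtain ⟨s, hs, hsx⟩ : ∃ s ∉ p.asIdeal, ∀ q ∈ p.asIdeal, s • q • x = 0 := by
      obtain ⟨F, hF⟩ := IsNoetherian.noetherian p.asIdeal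
      have (q : R) : ∃ s, q ∈ p.asIdeal → s ∉ p.asIdeal ∧ s • q • x = 0 := by
        by_cases hq : q ∈ p.asIdeal
        · obtain ⟨s, hs⟩ := hx' q hq
          exact ⟨s, fun _ ↦ hs⟩
        · exact ⟨0, fun h ↦ absurd h hq⟩
      choose σ hσ using this
      have hFp (q : R) (hq : q ∈ F) : q ∈ p.asIdeal := hF ▸ Submodule.subset_span hq
      refine ⟨∏ q ∈ F, σ q, fun h ↦ ?_, fun q hq ↦ ?_⟩
      · obtain ⟨q, hq, h⟩ := (p.2.prod_mem_iff).1 h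
        exact (hσ q (hFp q hq)).1 h
      · rw [← hF] at hq
        induction hq using Submodule.span_induction with
        | mem q hq =>
          obtain ⟨c, hc⟩ := Finset.dvd_prod_of_mem σ hq
          rw [hc, mul_comm, mul_smul, (hσ q (hFp q hq)).2, smul_zero]
        | zero => simp
        | add y z _ _ hy hz => rw [add_smul, smul_add, hy, hz, add_zero]
        | smul r y _ hy => rw [smul_eq_mul, mul_smul, smul_comm, hy, smul_zero]
    refine ⟨p.2, s • x, le_antisymm (fun q hq ↦ ?_) fun q hq ↦ ?_⟩
    · rw [Submodule.mem_colon_singleton, Submodule.mem_bot, smul_comm, hsx q hq]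
    · rw [Submodule.mem_colon_singleton, Submodule.mem_bot, smul_smul] at hq
      by_contra hqp
      exact hx _ (fun h ↦ (p.2.mem_or_mem h).elim hqp hs) hq

lemma IsLocallyAssociatedTo.map {x : A} (hx : IsLocallyAssociatedTo p x) (f : A →ₗ[R] B)
    (hf : ∀ a, f a = 0 → ∃ s ∉ p.asIdeal, s • a = 0) : IsLocallyAssociatedTo p (f x) := by
  refine ⟨fun s hs h ↦ ?_, fun q hq ↦ ?_⟩
  · obtain ⟨s', hs', h'⟩ := hf (s • x) (by rw [map_smul, h])
    exact hx.1 (s' * s) (fun h ↦ (p.2.mem_or_mem h).elim hs' hs) (by rw [mul_smul, h'])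
  · obtain ⟨s, hs, h⟩ := hx.2 q hq
    exact ⟨s, hs, by rw [← map_smul, ← map_smul, h, map_zero]⟩

lemma IsLocallyAssociatedTo.of_map {x : A} (f : A →ₗ[R] B)
    (hx : IsLocallyAssociatedTo p (f x))
    (hf : ∀ a, f a = 0 → ∃ s ∉ p.asIdeal, s • a = 0) : IsLocallyAssociatedTo p x := by
  refine ⟨fun s hs h ↦ hx.1 s hs (by rw [← map_smul, h, map_zero]), fun q hq ↦ ?_⟩
  obtain ⟨s, hs, h⟩ := hx.2 q hq
  obtain ⟨s', hs', h'⟩ := hf (s • q • x) (by rw [map_smul, map_smul, h])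
  exact ⟨s' * s, fun h ↦ (p.2.mem_or_mem h).elim hs' hs, by rw [mul_smul, h']⟩

lemma IsLocallyAssociatedTo.smul {x : A} (hx : IsLocallyAssociatedTo p x) {s : R}
    (hs : s ∉ p.asIdeal) : IsLocallyAssociatedTo p (s • x) := by
  refine ⟨fun r hr h ↦ hx.1 (r * s) (fun h ↦ (p.2.mem_or_mem h).elim hr hs)
    (by rw [mul_smul, h]), fun q hq ↦ ?_⟩
  obtain ⟨r, hr, h⟩ := hx.2 q hq
  exact ⟨r, hr, by rw [smul_comm q, smul_comm r, h, smul_zero]⟩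

lemma IsLocallyAssociatedTo.exists_of_exact {x : B} (hx : IsLocallyAssociatedTo p x)
    (f : A →ₗ[R] B) (g : B →ₗ[R] C)
    (hf : ∀ a, f a = 0 → ∃ s ∉ p.asIdeal, s • a = 0) (hfg : Function.Exact f g) :
    (∃ a : A, IsLocallyAssociatedTo p a) ∨ ∃ c : C, IsLocallyAssociatedTo p c := by
  by_cases h : ∃ s ∉ p.asIdeal, s • g x = 0
  · obtain ⟨s, hs, h⟩ := h
    obtain ⟨a, ha⟩ := (hfg (s • x)).1 (by rw [map_smul, h])
    exact .inl ⟨a, .of_map f (ha ▸ hx.smul hs) hf⟩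
  · refine .inr ⟨g x, fun s hs h' ↦ h ⟨s, hs, h'⟩, fun q hq ↦ ?_⟩
    obtain ⟨s, hs, h⟩ := hx.2 q hq
    exact ⟨s, hs, by rw [← map_smul, ← map_smul, h, map_zero]⟩

lemma Module.notMem_support_of_exact {f : A →ₗ[R] B} {g : B →ₗ[R] C}
    (hfg : Function.Exact f g) (hA : p ∉ Module.support R A) (hC : p ∉ Module.support R C) :
    p ∉ Module.support R B := by
  rw [Module.notMem_support_iff'] at *
  intro x
  obtain ⟨s, hs, h⟩ := hC (g x)
  obtain ⟨y, hy⟩ := (hfg (s • x)).1 (by rw [map_smul, h])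
  obtain ⟨t, ht, h⟩ := hA y
  exact ⟨t * s, fun h ↦ (p.2.mem_or_mem h).elim ht hs,
    by rw [mul_smul, ← hy, ← map_smul, h, map_zero]⟩

end AssociatedAtPrime

namespace CategoryTheory.Abelian.Ext

universe u

lemma subsingleton_of_isZero {C : Type*} [Category* C] [Abelian C] [HasExt C] {X : C}
    (hX : Limits.IsZero X) (Y : C) (n : ℕ) : Subsingleton (Ext X Y n) := by
  refine subsingleton_of_forall_eq 0 fun x ↦ ?_
  rw [← mk₀_id_comp x, hX.eq_of_src (𝟙 X) 0, mk₀_zero, zero_comp]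

variable {R : Type u} [CommRing R] {M : ModuleCat.{u} R} {p : PrimeSpectrum R}

lemma exists_smul_eq_zero_of_shortExact {S : ShortComplex (ModuleCat.{u} R)} (hS : S.ShortExact)
    {n : ℕ} (h : ∀ m < n, p ∉ Module.support R (Ext S.X₁ M m)) (x : Ext S.X₃ M n)
    (hx : (mk₀ S.g).comp x (zero_add n) = 0) : ∃ s ∉ p.asIdeal, s • x = 0 := by
  have := hS.epi_g
  cases n with
  | zero =>
    refine ⟨1, p.asIdeal.ne_top_iff_one.1 p.2.ne_top, ?_⟩
    rw [one_smul]
    exact precomp_mk₀_injective_of_epi M S.g (hx.trans (by simp))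
  | succ n =>
    obtain ⟨y, rfl⟩ := contravariant_sequence_exact₃ hS M x hx (add_comm 1 n)
    obtain ⟨s, hs, h⟩ := Module.notMem_support_iff'.1 (h n n.lt_succ_self) y
    exact ⟨s, hs, by rw [← comp_smul, h, comp_zero]⟩

variable [IsNoetherianRing R] {J : Ideal R}

/-- If `Ext (R ⧸ J) M` vanishes at `p` below degree `n`, then a surjection of finitely generated
`J`-torsion modules induces a map on `Ext` in degree `n` which is injective at `p`. -/
lemma exists_smul_eq_zero_of_surjective {n : ℕ}
    (h : ∀ m < n, ∀ (N : Type u) [AddCommGroup N] [Module R N] [Module.Finite R N],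
      J ≤ (Module.annihilator R N).radical → p ∉ Module.support R (Ext (ModuleCat.of R N) M m))
    {N N' : Type u} [AddCommGroup N] [Module R N] [Module.Finite R N]
    [AddCommGroup N'] [Module R N'] (hN : J ≤ (Module.annihilator R N).radical)
    {f : N →ₗ[R] N'} (hf : Function.Surjective f) (x : Ext (ModuleCat.of R N') M n)
    (hx : (mk₀ (ModuleCat.ofHom f)).comp x (zero_add n) = 0) :
    ∃ s ∉ p.asIdeal, s • x = 0 :=
  exists_smul_eq_zero_of_shortExact (LinearMap.shortExact_shortComplexKer hf)
    (fun m hm ↦ h m hm (LinearMap.ker f) (hN.trans (Ideal.radical_mono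
      ((LinearMap.ker f).subtype.annihilator_le_of_injective Subtype.val_injective)))) x hx

omit [IsNoetherianRing R] in
lemma exact_precompOfLinear {N₁ N₂ N₃ : Type u} [AddCommGroup N₁] [Module R N₁]
    [AddCommGroup N₂] [Module R N₂] [AddCommGroup N₃] [Module R N₃]
    {f : N₁ →ₗ[R] N₂} {g : N₂ →ₗ[R] N₃} (hf : Function.Injective f)
    (hg : Function.Surjective g) (hfg : Function.Exact f g) (n : ℕ) :
    Function.Exact ((mk₀ (ModuleCat.ofHom g)).precompOfLinear R M (zero_add n))
      ((mk₀ (ModuleCat.ofHom f)).precompOfLinear R M (zero_add n)) := by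
  have hS := ModuleCat.shortComplex_shortExact
    (ModuleCat.shortComplexOfCompEqZero f g hfg.linearMap_comp_eq_zero) hfg hf hg
  refine fun x ↦ ⟨fun hx ↦ contravariant_sequence_exact₂ hS M x hx, ?_⟩
  rintro ⟨x, rfl⟩
  change (mk₀ (ModuleCat.ofHom f)).comp ((mk₀ (ModuleCat.ofHom g)).comp x (zero_add n))
    (zero_add n) = 0
  rw [mk₀_comp_mk₀_assoc, ← ModuleCat.ofHom_comp, hfg.linearMap_comp_eq_zero]
  exact (congrArg (Ext.comp · x (zero_add n)) (mk₀_zero _ _)).trans (zero_comp ..)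

omit [IsNoetherianRing R] in
lemma exists_surjective_of_equiv_quotient_prime {N : Type*} [AddCommGroup N] [Module R N]
    (hN : J ≤ (Module.annihilator R N).radical) (q : PrimeSpectrum R) (e : N ≃ₗ[R] R ⧸ q.asIdeal) :
    ∃ f : (R ⧸ J) →ₗ[R] N, Function.Surjective f := by
  rw [e.annihilator_eq, Ideal.annihilator_quotient, q.2.radical] at hN
  exact ⟨e.symm.toLinearMap ∘ₗ Submodule.factor hN,
    e.symm.surjective.comp (Submodule.factor_surjective hN)⟩

/-- If `Ext (R ⧸ J) M` vanishes at `p` below degree `n`, then so does `Ext N M` for every finitely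
generated `J`-torsion module `N`. -/
theorem notMem_support_of_le_radical_annihilator {n : ℕ}
    (h : ∀ m < n, p ∉ Module.support R (Ext (ModuleCat.of R (R ⧸ J)) M m)) :
    ∀ m < n, ∀ (N : Type u) [AddCommGroup N] [Module R N] [Module.Finite R N],
      J ≤ (Module.annihilator R N).radical →
      p ∉ Module.support R (Ext (ModuleCat.of R N) M m) := by
  intro m
  induction m using Nat.strong_induction_on with
  | _ m ih =>
  intro hm N _ _ hfin
  induction hfin using IsNoetherianRing.induction_on_isQuotientEquivQuotientPrime R with
  | subsingleton N =>
    intro _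
    have := subsingleton_of_isZero (ModuleCat.isZero_of_subsingleton (ModuleCat.of R N)) M m
    simp [Module.support_eq_empty]
  | quotient N q e =>
    intro hN
    obtain ⟨f, hf⟩ := exists_surjective_of_equiv_quotient_prime hN q e
    rw [Module.notMem_support_iff']
    intro x
    obtain ⟨s, hs, hx⟩ := Module.notMem_support_iff'.1 (h m hm)
      ((mk₀ (ModuleCat.ofHom f)).comp x (zero_add m))
    obtain ⟨t, ht, hx⟩ := exists_smul_eq_zero_of_surjective
      (fun k hk ↦ ih k hk (hk.trans hm))
      (Ideal.le_radical.trans (Ideal.radical_mono Ideal.annihilator_quotient.ge))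
      hf (s • x) (by rw [comp_smul, hx])
    exact ⟨t * s, fun h ↦ (p.2.mem_or_mem h).elim ht hs, by rw [mul_smul, hx]⟩
  | exact N₁ N₂ N₃ f g hf hg hfg h₁ h₃ =>
    intro hN
    exact Module.notMem_support_of_exact (exact_precompOfLinear hf hg hfg m)
      (h₃ (hN.trans (Ideal.radical_mono (g.annihilator_le_of_surjective hg))))
      (h₁ (hN.trans (Ideal.radical_mono (f.annihilator_le_of_injective hf))))

/-- If `Ext (R ⧸ J) M` vanishes at `p` below degree `n`, then `p` is associated to
`Ext (R ⧸ J) M n` as soon as it is associated to `Ext N M n` for some finitely generated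
`J`-torsion module `N`. -/
theorem mem_associatedPrimes_of_le_radical_annihilator {n : ℕ}
    (h : ∀ m < n, p ∉ Module.support R (Ext (ModuleCat.of R (R ⧸ J)) M m))
    (N : Type u) [AddCommGroup N] [Module R N] [hfin : Module.Finite R N]
    (hN : J ≤ (Module.annihilator R N).radical)
    (hp : p.asIdeal ∈ associatedPrimes R (Ext (ModuleCat.of R N) M n)) :
    p.asIdeal ∈ associatedPrimes R (Ext (ModuleCat.of R (R ⧸ J)) M n) := by
  have hV := notMem_support_of_le_radical_annihilator h
  rw [mem_associatedPrimes_iff_exists_isLocallyAssociatedTo] at hp ⊢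
  revert hN hp
  induction hfin using IsNoetherianRing.induction_on_isQuotientEquivQuotientPrime R with
  | subsingleton N =>
    rintro - ⟨x, hx⟩
    have := subsingleton_of_isZero (ModuleCat.isZero_of_subsingleton (ModuleCat.of R N)) M n
    exact absurd (Subsingleton.elim _ _) (hx.1 1 (p.asIdeal.ne_top_iff_one.1 p.2.ne_top))
  | quotient N q e =>
    rintro hN ⟨x, hx⟩
    obtain ⟨f, hf⟩ := exists_surjective_of_equiv_quotient_prime hN q e
    exact ⟨_, hx.map ((mk₀ (ModuleCat.ofHom f)).precompOfLinear R M (zero_add n)) fun y hy ↦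
      exists_smul_eq_zero_of_surjective hV
        (Ideal.le_radical.trans (Ideal.radical_mono Ideal.annihilator_quotient.ge)) hf y hy⟩
  | exact N₁ N₂ N₃ f g hf hg hfg h₁ h₃ =>
    rintro hN ⟨x, hx⟩
    exact (hx.exists_of_exact _ _ (fun y hy ↦ exists_smul_eq_zero_of_surjective hV hN hg y hy)
      (exact_precompOfLinear hf hg hfg n)).elim
      (h₃ (hN.trans (Ideal.radical_mono (g.annihilator_le_of_surjective hg))))
      (h₁ (hN.trans (Ideal.radical_mono (f.annihilator_le_of_injective hf))))

end CategoryTheory.Abelian.Ext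

section FilteredColimit

open Limits

universe u

variable {R : Type u} [CommRing R] {D : Type} [SmallCategory D] [IsFiltered D]

lemma ModuleCat.preservesColimitsOfShape_forget_of_isFiltered :
    PreservesColimitsOfShape D (forget (ModuleCat.{u} R)) :=
  have := preservesFilteredColimitsOfSize_shrink.{0, u, 0, u} (forget (ModuleCat.{u} R))
  PreservesFilteredColimitsOfSize.preserves_filtered_colimits D

variable (F : D ⥤ ModuleCat.{u} R ⥤ ModuleCat.{u} R) (M : ModuleCat.{u} R)

lemma ModuleCat.exists_colimit_ι_app_eq (x : (colimit F).obj M) :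
    ∃ j, ∃ y : (F.obj j).obj M, ((colimit.ι F j).app M).hom y = x :=
  have := preservesColimitsOfShape_forget_of_isFiltered (R := R) (D := D)
  Concrete.isColimit_exists_rep _
    (isColimitOfPreserves ((evaluation _ _).obj M) (colimit.isColimit F)) x

lemma ModuleCat.exists_map_app_eq_zero {j : D} (y : (F.obj j).obj M)
    (hy : ((colimit.ι F j).app M).hom y = 0) :
    ∃ k, ∃ g : j ⟶ k, ((F.map g).app M).hom y = 0 := by
  have := preservesColimitsOfShape_forget_of_isFiltered (R := R) (D := D)
  obtain ⟨k, g, g', h⟩ := Concrete.isColimit_exists_of_rep_eq _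
    (isColimitOfPreserves ((evaluation _ _).obj M) (colimit.isColimit F))
    (i := j) (j := j) y 0 (hy.trans (map_zero ((colimit.ι F j).app M).hom).symm)
  exact ⟨k, g, h.trans (map_zero ((F.map g').app M).hom)⟩

end FilteredColimit

namespace localCohomology

universe u

variable {R : Type u} [CommRing R] (a : Ideal R) (M : ModuleCat.{u} R) (i : ℕ)

/-- The canonical map from `Ext (R ⧸ a ^ n) M i` to local cohomology. -/
noncomputable def ofExt (n : ℕ) :
    Abelian.Ext (ModuleCat.of R (R ⧸ a ^ n)) M i →ₗ[R] (localCohomology a i).obj M :=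
  have := hasColimitDiagram.{u, 0} (idealPowersDiagram a) i
  ((Limits.colimit.ι (diagram (idealPowersDiagram a) i) (.op (.op n))).app M).hom ∘ₗ
    ((projectiveResolution (ModuleCat.of R (R ⧸ a ^ n))).extLinearEquiv R M i).symm.toLinearMap

lemma ofExt_extLinearEquiv (n : ℕ)
    (y : ((Ext R (ModuleCat.{u} R) i).obj (.op (ModuleCat.of R (R ⧸ a ^ n)))).obj M) :
    ofExt a M i n ((projectiveResolution _).extLinearEquiv R M i y) =
      ((Limits.colimit.ι (diagram (idealPowersDiagram a) i) (.op (.op n))).app M).hom y :=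
  congrArg ((Limits.colimit.ι (diagram (idealPowersDiagram a) i) (.op (.op n))).app M).hom
    (LinearEquiv.symm_apply_apply _ y)

lemma exists_ofExt_eq (x : (localCohomology a i).obj M) :
    ∃ n y, ofExt a M i n y = x := by
  obtain ⟨⟨⟨n⟩⟩, y, hy⟩ :=
    ModuleCat.exists_colimit_ι_app_eq (diagram (idealPowersDiagram a) i) M x
  exact ⟨n, _, (ofExt_extLinearEquiv a M i n y).trans hy⟩

lemma ringModIdeals_map_surjective {D : Type*} [SmallCategory D] (I : D ⥤ Ideal R) {j k : D}
    (g : j ⟶ k) : Function.Surjective ((ringModIdeals I).map g).hom := fun z ↦ by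
  obtain ⟨r, rfl⟩ := Submodule.Quotient.mk_surjective _ z
  exact ⟨Submodule.Quotient.mk r, rfl⟩

lemma mk₀_comp_extLinearEquiv_eq_zero {j k : ℕᵒᵖᵒᵖ} (g : j ⟶ k)
    (y : ((diagram (idealPowersDiagram a) i).obj j).obj M)
    (hy : (((diagram (idealPowersDiagram a) i).map g).app M).hom y = 0) :
    (Abelian.Ext.mk₀ ((ringModIdeals (idealPowersDiagram a)).map g.unop)).comp
      ((projectiveResolution ((ringModIdeals (idealPowersDiagram a)).obj j.unop)).extLinearEquiv
        R M i y) (zero_add i) = 0 :=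
  (ProjectiveResolution.extLinearEquiv_naturality (projectiveResolution _) _ M i _ y).symm.trans
    ((congrArg _ hy).trans (map_zero _))

lemma exists_comp_eq_zero_of_ofExt_eq_zero {n : ℕ}
    (y : Abelian.Ext (ModuleCat.of R (R ⧸ a ^ n)) M i) (hy : ofExt a M i n y = 0) :
    ∃ (m : ℕ) (f : (R ⧸ a ^ m) →ₗ[R] (R ⧸ a ^ n)), Function.Surjective f ∧
      (Abelian.Ext.mk₀ (ModuleCat.ofHom f)).comp y (zero_add i) = 0 := by
  obtain ⟨y, rfl⟩ := (projectiveResolution (ModuleCat.of R (R ⧸ a ^ n))).extLinearEquiv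
    R M i |>.surjective y
  have hy' : ((Limits.colimit.ι (diagram (idealPowersDiagram a) i) (.op (.op n))).app M).hom
      y = 0 := by
    rw [← ofExt_extLinearEquiv]
    exact hy
  obtain ⟨m, g, h⟩ := ModuleCat.exists_map_app_eq_zero (diagram (idealPowersDiagram a) i) M
    (j := .op (.op n)) y hy'
  exact ⟨m.unop.unop, ((ringModIdeals (idealPowersDiagram a)).map g.unop).hom,
    ringModIdeals_map_surjective _ _, mk₀_comp_extLinearEquiv_eq_zero a M i g y h⟩

end localCohomology

namespace localCohomology

universe u

open Abelian

variable {R : Type u} [CommRing R] [IsNoetherianRing R] (a : Ideal R) (M : ModuleCat.{u} R)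
  {p : PrimeSpectrum R}

omit [IsNoetherianRing R] in
lemma pow_one_le_radical_annihilator (n : ℕ) :
    a ^ 1 ≤ (Module.annihilator R (R ⧸ a ^ n)).radical := by
  rw [pow_one, Ideal.annihilator_quotient]
  exact fun x hx ↦ ⟨n, Ideal.pow_mem_pow hx n⟩

lemma exists_smul_eq_zero_of_ofExt_eq_zero {i : ℕ}
    (h : ∀ j < i, p ∉ Module.support R (Ext (ModuleCat.of R (R ⧸ a ^ 1)) M j)) {n : ℕ}
    (y : Ext (ModuleCat.of R (R ⧸ a ^ n)) M i) (hy : ofExt a M i n y = 0) :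
    ∃ s ∉ p.asIdeal, s • y = 0 := by
  obtain ⟨m, f, hf, hfy⟩ := exists_comp_eq_zero_of_ofExt_eq_zero a M i y hy
  exact Ext.exists_smul_eq_zero_of_surjective (Ext.notMem_support_of_le_radical_annihilator h)
    (pow_one_le_radical_annihilator a m) hf y hfy

lemma notMem_support_ext_of_notMem_support {i : ℕ}
    (h : ∀ j < i, p ∉ Module.support R ((localCohomology a j).obj M)) :
    ∀ j < i, p ∉ Module.support R (Ext (ModuleCat.of R (R ⧸ a ^ 1)) M j) := by
  intro j
  induction j using Nat.strong_induction_on with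
  | _ j ih =>
  intro hj
  rw [Module.notMem_support_iff']
  intro y
  obtain ⟨s, hs, hy⟩ := Module.notMem_support_iff'.1 (h j hj) (ofExt a M j 1 y)
  obtain ⟨t, ht, hy⟩ := exists_smul_eq_zero_of_ofExt_eq_zero a M
    (fun k hk ↦ ih k hk (hk.trans hj)) (s • y) (by rw [map_smul, hy])
  exact ⟨t * s, fun h ↦ (p.2.mem_or_mem h).elim ht hs, by rw [mul_smul, hy]⟩

/-- A prime associated to `H_a^t(M)` which is not in the support of `H_a^i(M)` for `i < t` is
associated to `Ext^t(R ⧸ a, M)`. -/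
theorem mem_associatedPrimes_ext {t : ℕ}
    (h : ∀ i < t, p ∉ Module.support R ((localCohomology a i).obj M))
    (hp : p.asIdeal ∈ associatedPrimes R ((localCohomology a t).obj M)) :
    p.asIdeal ∈ associatedPrimes R (Ext (ModuleCat.of R (R ⧸ a ^ 1)) M t) := by
  have h' := notMem_support_ext_of_notMem_support a M h
  obtain ⟨x, hx⟩ := mem_associatedPrimes_iff_exists_isLocallyAssociatedTo.1 hp
  obtain ⟨n, y, rfl⟩ := exists_ofExt_eq a M t x
  exact Ext.mem_associatedPrimes_of_le_radical_annihilator h' _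
    (pow_one_le_radical_annihilator a n)
    (mem_associatedPrimes_iff_exists_isLocallyAssociatedTo.2
      ⟨y, hx.of_map _ (exists_smul_eq_zero_of_ofExt_eq_zero a M h')⟩)

end localCohomology

/-- If `M` is finitely generated and `Supp H_a^i(M)` is finite for all `i < t`,
then `Ass H_a^t(M)` is finite. -/
theorem associatedPrimes_finite_of_finite_support_below
    {R : Type} [CommRing R] [IsNoetherianRing R] (a : Ideal R)
    (M : Type) [AddCommGroup M] [Module R M] [Module.Finite R M] (t : ℕ)
    (hs : ∀ i < t,
      (Module.support R ((localCohomology a i).obj (ModuleCat.of R M))).Finite) :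
    (associatedPrimes R ((localCohomology a t).obj (ModuleCat.of R M))).Finite := by
  have hfin : (⋃ i ∈ Set.Iio t,
      Module.support R ((localCohomology a i).obj (ModuleCat.of R M))).Finite :=
    (Set.finite_Iio t).biUnion hs
  refine ((hfin.image PrimeSpectrum.asIdeal).union (associatedPrimes.finite R
    (Abelian.Ext (ModuleCat.of R (R ⧸ a ^ 1)) (ModuleCat.of R M) t))).subset fun P hP ↦ ?_
  let p : PrimeSpectrum R := ⟨P, hP.isPrime⟩
  by_cases hp : ∃ i < t, p ∈ Module.support R ((localCohomology a i).obj (ModuleCat.of R M))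
  · obtain ⟨i, hi, hp⟩ := hp
    exact .inl ⟨p, Set.mem_biUnion hi hp, rfl⟩
  · push Not at hp
    exact .inr (localCohomology.mem_associatedPrimes_ext a _ hp hP)
end

section
/- Let a be an ideal of R and M a finitely generated R-module. If the local cohomology modules H_a^0(M), ..., H_a^{t-1}(M) are all finitely generated, then Ass_R(H_a^t(M)) is finite. -/
open CategoryTheory

noncomputable section

universe u

namespace ExtComparison

open Limits Opposite

variable {R : Type u} [CommRing R]

section

variable {X : ModuleCat.{u} R} (P : ProjectiveResolution X) (Y : ModuleCat.{u} R) (n : ℕ)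

/-- The contravariant functor `Hom(-, Y)`. -/
abbrev homFunctor : ModuleCat.{u} R ⥤ (ModuleCat.{u} R)ᵒᵖ :=
  ((linearYoneda R (ModuleCat.{u} R)).obj Y).rightOp

/-- The complex `Hom(P, Y)`, as a chain complex in the opposite category. -/
abbrev homComplex : ChainComplex (ModuleCat.{u} R)ᵒᵖ ℕ :=
  ((homFunctor Y).mapHomologicalComplex _).obj P.complex

/-- The `n`-cocycles of `Hom(P, Y)`. -/
abbrev Cocycles : ModuleCat.{u} R := ((homComplex P Y).opcycles n).unop

/-- The morphism underlying a cocycle. -/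
def Cocycles.val : Cocycles P Y n →ₗ[R] (P.complex.X n ⟶ Y) :=
  ((homComplex P Y).pOpcycles n).unop.hom

lemma Cocycles.val_injective : Function.Injective (Cocycles.val P Y n) :=
  (ModuleCat.mono_iff_injective ((homComplex P Y).pOpcycles n).unop).1 inferInstance

lemma Cocycles.d_comp_val (z : Cocycles P Y n) :
    P.complex.d (n + 1) n ≫ Cocycles.val P Y n z = 0 :=
  congr($(congrArg Quiver.Hom.unop ((homComplex P Y).d_pOpcycles (n + 1) n)).hom z)

lemma Cocycles.exists_val_eq (f : P.complex.X n ⟶ Y) (hf : P.complex.d (n + 1) n ≫ f = 0) :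
    ∃ z, Cocycles.val P Y n z = f := by
  have h : (ShortComplex.mk ((homComplex P Y).d (n + 1) n) ((homComplex P Y).pOpcycles n)
      ((homComplex P Y).d_pOpcycles _ _)).Exact :=
    ShortComplex.exact_of_g_is_cokernel _
      ((homComplex P Y).opcyclesIsCokernel (n + 1) n (by simp))
  exact (ShortComplex.moduleCat_exact_iff _).1 h.unop f hf

/-- The class of a cocycle in the derived functor `Ext`. -/
def toDerivedExt : Cocycles P Y n →ₗ[R] ((Ext R (ModuleCat.{u} R) n).obj (op X)).obj Y :=
  ((P.isoLeftDerivedObj (homFunctor Y) n).hom.unop).hom ∘ₗ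
    ((homComplex P Y).homologyι n).unop.hom

lemma toDerivedExt_surjective : Function.Surjective (toDerivedExt P Y n) :=
  ((ModuleCat.epi_iff_surjective (P.isoLeftDerivedObj (homFunctor Y) n).hom.unop).1
    inferInstance).comp
    ((ModuleCat.epi_iff_surjective ((homComplex P Y).homologyι n).unop).1 inferInstance)

lemma toDerivedExt_eq_zero_iff (z : Cocycles P Y n) :
    toDerivedExt P Y n z = 0 ↔ ∃ g : P.complex.X ((ComplexShape.down ℕ).next n) ⟶ Y,
      P.complex.d n _ ≫ g = Cocycles.val P Y n z := by
  have h : (ShortComplex.mk ((homComplex P Y).homologyι n)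
      ((homComplex P Y).fromOpcycles n ((ComplexShape.down ℕ).next n)) (by simp)).Exact :=
    ShortComplex.exact_of_f_is_kernel _
      ((homComplex P Y).homologyIsKernel n _ rfl)
  have inj : Function.Injective (P.isoLeftDerivedObj (homFunctor Y) n).hom.unop :=
    (ModuleCat.mono_iff_injective _).1 inferInstance
  have key (g : P.complex.X ((ComplexShape.down ℕ).next n) ⟶ Y) :
      Cocycles.val P Y n (((homComplex P Y).fromOpcycles n _).unop.hom g) =
        P.complex.d n _ ≫ g :=
    congr($(congrArg Quiver.Hom.unop ((homComplex P Y).p_fromOpcycles n _)).hom g)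
  constructor
  · intro hz
    obtain ⟨g, hg⟩ := (ShortComplex.moduleCat_exact_iff _).1 h.unop z
      (inj (hz.trans (map_zero (P.isoLeftDerivedObj (homFunctor Y) n).hom.unop.hom).symm))
    refine ⟨g, ?_⟩
    rw [← key g]
    exact congrArg _ hg
  · rintro ⟨g, hg⟩
    rw [← key g] at hg
    obtain rfl := Cocycles.val_injective P Y n hg
    have h0 : ((homComplex P Y).homologyι n).unop.hom
        (((homComplex P Y).fromOpcycles n _).unop.hom g) = 0 :=
      congr($(congrArg Quiver.Hom.unop ((homComplex P Y).homologyι_comp_fromOpcycles n _)).hom g)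
    exact (congrArg _ h0).trans
      (map_zero (P.isoLeftDerivedObj (homFunctor Y) n).hom.unop.hom)

/-- The class of a cocycle in `Abelian.Ext`. -/
def toExt : Cocycles P Y n →ₗ[R] Abelian.Ext X Y n where
  toFun z := P.extMk (Cocycles.val P Y n z) (n + 1) rfl (Cocycles.d_comp_val P Y n z)
  map_add' z w := by
    rw [P.add_extMk]
    simp
  map_smul' r z := by
    dsimp
    rw [Abelian.Ext.smul_eq_comp_mk₀, P.extMk_comp_mk₀]
    simp

lemma toExt_surjective : Function.Surjective (toExt P Y n) := by
  intro α
  obtain ⟨f, hf, rfl⟩ := P.extMk_surjective α (n + 1) rfl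
  obtain ⟨z, rfl⟩ := Cocycles.exists_val_eq P Y n f hf
  exact ⟨z, rfl⟩

lemma toExt_eq_zero_iff (z : Cocycles P Y n) :
    toExt P Y n z = 0 ↔ ∃ g : P.complex.X ((ComplexShape.down ℕ).next n) ⟶ Y,
      P.complex.d n _ ≫ g = Cocycles.val P Y n z := by
  rcases n with _ | n
  · have h0 : P.complex.d 0 ((ComplexShape.down ℕ).next 0) = 0 := P.complex.shape _ _ (by simp)
    simp only [h0, zero_comp, exists_const]
    constructor
    · intro hz
      have hz' : P.extMk (Cocycles.val P Y 0 z) (0 + 1) rfl (Cocycles.d_comp_val P Y 0 z) = 0 := hz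
      rw [← P.extEquivCohomologyClass.apply_eq_iff_eq,
        P.extEquivCohomologyClass_extMk, P.extEquivCohomologyClass_zero,
        CochainComplex.HomComplex.CohomologyClass.mk_eq_zero_iff,
        CochainComplex.HomComplex.Cocycle.toSingleMk_mem_coboundaries_iff _ _ _ _ _ 1
          (by simp)] at hz'
      obtain ⟨g, hg⟩ := hz'
      have : P.cochainComplex.d (-((0 : ℕ) : ℤ)) 1 = 0 :=
        (P.cochainComplex.isZero_of_isStrictlyLE 0 1 (by simp)).eq_of_tgt _ _
      rw [this, zero_comp] at hg
      rw [← cancel_epi (P.cochainComplexXIso (-((0 : ℕ) : ℤ)) 0 rfl).hom, ← hg, comp_zero]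
    · intro hz
      change P.extMk (Cocycles.val P Y 0 z) (0 + 1) rfl (Cocycles.d_comp_val P Y 0 z) = 0
      simp only [← hz]
      exact P.extMk_zero _ _
  · have : (ComplexShape.down ℕ).next (n + 1) = n := by simp
    rw [this]
    exact P.extMk_eq_zero_iff (Cocycles.val P Y (n + 1) z) _ rfl (Cocycles.d_comp_val P Y _ z) n rfl

/-- The derived functor `Ext` agrees with `Abelian.Ext`. -/
def derivedExtEquiv :
    ((Ext R (ModuleCat.{u} R) n).obj (op X)).obj Y ≃ₗ[R] Abelian.Ext X Y n :=
  ((toDerivedExt P Y n).quotKerEquivOfSurjective (toDerivedExt_surjective P Y n)).symm ≪≫ₗ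
    Submodule.quotEquivOfEq _ _ (by
      ext z
      simp only [LinearMap.mem_ker, toDerivedExt_eq_zero_iff, toExt_eq_zero_iff]) ≪≫ₗ
    (toExt P Y n).quotKerEquivOfSurjective (toExt_surjective P Y n)

lemma derivedExtEquiv_toDerivedExt (z : Cocycles P Y n) :
    derivedExtEquiv P Y n (toDerivedExt P Y n z) = toExt P Y n z := by
  have : ((toDerivedExt P Y n).quotKerEquivOfSurjective (toDerivedExt_surjective P Y n)).symm
      (toDerivedExt P Y n z) = Submodule.Quotient.mk z := by
    rw [LinearEquiv.symm_apply_eq]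
    rfl
  simp only [derivedExtEquiv, LinearEquiv.trans_apply, this]
  rfl

end

lemma derivedExtEquiv_map {X X' : ModuleCat.{u} R} (P : ProjectiveResolution X)
    (P' : ProjectiveResolution X') (Y : ModuleCat.{u} R) (n : ℕ) (g : X' ⟶ X)
    (x : ((Ext R (ModuleCat.{u} R) n).obj (op X)).obj Y) :
    derivedExtEquiv P' Y n ((((Ext R (ModuleCat.{u} R) n).map g.op).app Y).hom x) =
      (Abelian.Ext.mk₀ g).comp (derivedExtEquiv P Y n x) (zero_add n) := by
  obtain ⟨z, rfl⟩ := toDerivedExt_surjective P Y n x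
  have hφ : (ProjectiveResolution.lift g P' P).f 0 ≫ P.π.f 0 = P'.π.f 0 ≫ g :=
    (ProjectiveResolution.lift_commutes_zero g P' P)
  let φ : P'.Hom P g := ⟨ProjectiveResolution.lift g P' P, hφ⟩
  let ψ := ((homFunctor Y).mapHomologicalComplex (ComplexShape.down ℕ)).map φ.hom
  let w : Cocycles P' Y n := (HomologicalComplex.opcyclesMap ψ n).unop.hom z
  have hw : Cocycles.val P' Y n w = φ.hom.f n ≫ Cocycles.val P Y n z :=
    congr($(congrArg Quiver.Hom.unop (HomologicalComplex.p_opcyclesMap ψ n)).hom z)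
  have hmap : (((Ext R (ModuleCat.{u} R) n).map g.op).app Y).hom (toDerivedExt P Y n z) =
      toDerivedExt P' Y n w := by
    have h₁ := P'.isoLeftDerivedObj_hom_naturality g P φ.hom hφ (homFunctor Y) n
    have h₂ := HomologicalComplex.homologyι_naturality ψ n
    exact (congr($(congrArg Quiver.Hom.unop h₁).hom
      (((homComplex P Y).homologyι n).unop.hom z))).trans
        (congrArg (P'.isoLeftDerivedObj (homFunctor Y) n).hom.unop.hom
          congr($(congrArg Quiver.Hom.unop h₂).hom z))
  rw [hmap, derivedExtEquiv_toDerivedExt, derivedExtEquiv_toDerivedExt]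
  dsimp [toExt]
  rw [P.mk₀_comp_extMk _ _ _ _ φ]
  simp only [hw]

end ExtComparison

namespace PowExt

open Limits Opposite

variable {R : Type u} [CommRing R] (a : Ideal R)

/-- The module `R ⧸ a ^ n`. -/
abbrev powQuot (n : ℕ) : ModuleCat.{u} R := ModuleCat.of R (R ⧸ a ^ n)

/-- The projection `R ⧸ a ^ n ⟶ R ⧸ a ^ m`. -/
def powQuotMap {m n : ℕ} (h : m ≤ n) : powQuot a n ⟶ powQuot a m :=
  ModuleCat.ofHom (Submodule.mapQ _ _ LinearMap.id (Ideal.pow_le_pow_right h))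

@[simp]
lemma powQuotMap_refl (n : ℕ) (h : n ≤ n) : powQuotMap a h = 𝟙 _ := by
  ext : 1
  exact Submodule.linearMap_qext _ rfl

@[simp]
lemma powQuotMap_comp {l m n : ℕ} (h : l ≤ m) (h' : m ≤ n) :
    powQuotMap a h' ≫ powQuotMap a h = powQuotMap a (h.trans h') := by
  ext : 1
  exact Submodule.linearMap_qext _ rfl

lemma pow_smul_powQuot {n : ℕ} {r : R} (hr : r ∈ a ^ n) (x : powQuot a n) : r • x = 0 := by
  obtain ⟨x, rfl⟩ := Submodule.mkQ_surjective _ x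
  exact (Submodule.Quotient.mk_eq_zero _).2 (Ideal.mul_mem_right x _ hr)

variable (M : ModuleCat.{u} R) (i : ℕ)

/-- The map on `Ext` induced by `powQuotMap`. -/
def transition (m n : ℕ) (h : m ≤ n) :
    Abelian.Ext (powQuot a m) M i →ₗ[R] Abelian.Ext (powQuot a n) M i :=
  (Abelian.Ext.mk₀ (powQuotMap a h)).precompOfLinear R M (zero_add i)

variable {M i} in
lemma transition_apply {m n : ℕ} (h : m ≤ n) (x : Abelian.Ext (powQuot a m) M i) :
    transition a M i m n h x = (Abelian.Ext.mk₀ (powQuotMap a h)).comp x (zero_add i) := rfl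

instance : DirectedSystem (fun n ↦ Abelian.Ext (powQuot a n) M i)
    (fun m n h ↦ transition a M i m n h) where
  map_self n x := by simp [transition_apply]
  map_map l m n h h' x := by
    simp only [transition_apply, Abelian.Ext.mk₀_comp_mk₀_assoc, powQuotMap_comp]

/-- The direct limit of `Ext (R ⧸ a ^ n) M i`. -/
abbrev LimExt : Type u :=
  Module.DirectLimit (fun n ↦ Abelian.Ext (powQuot a n) M i) (transition a M i)

/-- The diagram whose colimit is the local cohomology of `M`. -/
abbrev derivedSystem : (ℕᵒᵖ)ᵒᵖ ⥤ ModuleCat.{u} R :=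
  localCohomology.diagram (localCohomology.idealPowersDiagram a) i ⋙
    (evaluation _ _).obj M

/-- The cocone exhibiting local cohomology as a colimit. -/
def derivedCocone : Cocone (derivedSystem a M i) :=
  ((evaluation _ _).obj M).mapCocone
    (colimit.cocone (localCohomology.diagram (localCohomology.idealPowersDiagram a) i))

/-- Evaluation at `M` preserves the colimit defining local cohomology. -/
def derivedCoconeIsColimit : IsColimit (derivedCocone a M i) :=
  isColimitOfPreserves ((evaluation _ _).obj M) (colimit.isColimit _)

/-- The terms of `derivedSystem` are the modules `Abelian.Ext (R ⧸ a ^ n) M i`. -/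
def systemEquiv (n : ℕ) :
    (derivedSystem a M i).obj (op (op n)) ≃ₗ[R] Abelian.Ext (powQuot a n) M i :=
  ExtComparison.derivedExtEquiv (projectiveResolution (powQuot a n)) M i

lemma systemEquiv_map {m n : ℕ} (h : m ≤ n) (x : (derivedSystem a M i).obj (op (op m))) :
    systemEquiv a M i n ((derivedSystem a M i).map (homOfLE h).op.op x) =
      transition a M i m n h (systemEquiv a M i m x) :=
  ExtComparison.derivedExtEquiv_map (projectiveResolution (powQuot a m))
    (projectiveResolution (powQuot a n)) M i (powQuotMap a h) x

/-- The map from the `n`-th term to local cohomology. -/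
def toColimit (n : ℕ) : Abelian.Ext (powQuot a n) M i →ₗ[R] (localCohomology a i).obj M :=
  ((derivedCocone a M i).ι.app (op (op n))).hom.comp (systemEquiv a M i n).symm.toLinearMap

lemma toColimit_systemEquiv (n : ℕ) (x : (derivedSystem a M i).obj (op (op n))) :
    toColimit a M i n (systemEquiv a M i n x) = (derivedCocone a M i).ι.app (op (op n)) x :=
  congrArg ((derivedCocone a M i).ι.app (op (op n))).hom
    ((systemEquiv a M i n).symm_apply_apply x)

/-- The comparison map to local cohomology. -/
def toLocalCohomology : LimExt a M i →ₗ[R] (localCohomology a i).obj M :=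
  Module.DirectLimit.lift R ℕ _ _ (toColimit a M i) (fun m n h x ↦ by
    obtain ⟨x, rfl⟩ := (systemEquiv a M i m).surjective x
    rw [← systemEquiv_map, toColimit_systemEquiv, toColimit_systemEquiv]
    exact congr($((derivedCocone a M i).w (homOfLE h).op.op).hom x))

lemma toLocalCohomology_bijective : Function.Bijective (toLocalCohomology a M i) := by
  have := preservesSmallestFilteredColimits_of_preservesFilteredColimits (forget (ModuleCat.{u} R))
  constructor
  · rw [injective_iff_map_eq_zero]
    intro y hy
    obtain ⟨n, x, rfl⟩ := Module.DirectLimit.exists_of y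
    obtain ⟨x, rfl⟩ := (systemEquiv a M i n).surjective x
    rw [toLocalCohomology, Module.DirectLimit.lift_of, toColimit_systemEquiv] at hy
    have hx : (derivedCocone a M i).ι.app (op (op n)) x =
        (derivedCocone a M i).ι.app (op (op n)) 0 := hy.trans (map_zero _).symm
    obtain ⟨k, f, g, hk⟩ := Concrete.isColimit_exists_of_rep_eq
      (derivedSystem a M i) (derivedCoconeIsColimit a M i) _ _ hx
    rw [map_zero] at hk
    have hnk : n ≤ k.unop.unop := leOfHom f.unop.unop
    have hk' := systemEquiv_map a M i hnk x
    have : (homOfLE hnk).op.op = f := Subsingleton.elim _ _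
    rw [this, hk, map_zero] at hk'
    rw [← Module.DirectLimit.of_f (hij := hnk), ← hk', map_zero]
  · intro y
    obtain ⟨k, x, hx⟩ := Concrete.isColimit_exists_rep
      (derivedSystem a M i) (derivedCoconeIsColimit a M i) y
    refine ⟨Module.DirectLimit.of R ℕ _ _ k.unop.unop (systemEquiv a M i _ x), ?_⟩
    rw [toLocalCohomology, Module.DirectLimit.lift_of, toColimit_systemEquiv]
    exact hx

/-- Local cohomology is the direct limit of `Abelian.Ext (R ⧸ a ^ n) M i`. -/
def limExtEquiv : LimExt a M i ≃ₗ[R] (localCohomology a i).obj M :=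
  LinearEquiv.ofBijective _ (toLocalCohomology_bijective a M i)

end PowExt

namespace PowExt

variable {R : Type u} [CommRing R] (a : Ideal R)

lemma exists_extClass_comp_eq {S : ShortComplex (ModuleCat.{u} R)} (hS : S.ShortExact)
    [Projective S.X₂] {G : ModuleCat.{u} R} {j : ℕ} (e : Abelian.Ext S.X₃ G (j + 1)) :
    ∃ e' : Abelian.Ext S.X₁ G j, hS.extClass.comp e' (add_comm 1 j) = e :=
  Abelian.Ext.contravariant_sequence_exact₃ hS G e (Abelian.Ext.eq_zero_of_projective _) _

lemma mk₀_comp_extClass_comp_eq_zero {S S' : ShortComplex (ModuleCat.{u} R)}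
    (hS' : S'.ShortExact) (hS : S.ShortExact) (φ : S' ⟶ S) {G : ModuleCat.{u} R} {j : ℕ}
    {e : Abelian.Ext S.X₁ G j} (he : (Abelian.Ext.mk₀ φ.τ₁).comp e (zero_add j) = 0) :
    (Abelian.Ext.mk₀ φ.τ₃).comp (hS.extClass.comp e (add_comm 1 j)) (zero_add (j + 1)) = 0 := by
  rw [← Abelian.Ext.comp_assoc (a₁₂ := 1) _ _ _ (by lia) (by lia) (by lia),
    ← hS'.extClass_naturality hS φ,
    Abelian.Ext.comp_assoc (a₂₃ := j) _ _ _ (by lia) (by lia) (by lia), he,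
    Abelian.Ext.comp_zero]

/-- By Artin–Rees, morphisms with image in a high enough power of `a` times `N` induce zero on
extensions of `N` by a module killed by a power of `a`. -/
theorem ext_comp_eq_zero_of_range_le_pow_smul [IsNoetherianRing R] {G : ModuleCat.{u} R} {k : ℕ}
    (hG : ∀ r ∈ a ^ k, ∀ x : G, r • x = 0) (j : ℕ) (N : ModuleCat.{u} R) [Module.Finite R N] :
    ∃ m, ∀ (X : ModuleCat.{u} R) (f : X ⟶ N), LinearMap.range f.hom ≤ a ^ m • ⊤ →
      ∀ e : Abelian.Ext N G j, (Abelian.Ext.mk₀ f).comp e (zero_add j) = 0 := by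
  induction j generalizing N with
  | zero =>
    refine ⟨k, fun X f hf e ↦ ?_⟩
    obtain ⟨g, rfl⟩ := (Abelian.Ext.mk₀_bijective N G).2 e
    have hg : a ^ k • (⊤ : Submodule R N) ≤ LinearMap.ker g.hom :=
      Submodule.smul_le.2 fun r hr x _ ↦ by
        rw [LinearMap.mem_ker, map_smul]
        exact hG r hr _
    have hfg : f ≫ g = 0 := by
      ext x
      exact hg (hf ⟨x, rfl⟩)
    rw [Abelian.Ext.mk₀_comp_mk₀, hfg, Abelian.Ext.mk₀_zero]
  | succ j ih =>
    obtain ⟨n, π, hπ⟩ := Module.Finite.exists_fin' R N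
    let F : ModuleCat.{u} R := ModuleCat.of R (Fin n → R)
    let p : F →ₗ[R] N := π
    have hS := LinearMap.shortExact_shortComplexKer (f := p) hπ
    obtain ⟨m, hm⟩ := ih (ModuleCat.of R (LinearMap.ker p))
    obtain ⟨c, hc⟩ := Ideal.exists_pow_inf_eq_pow_smul a (LinearMap.ker p)
    refine ⟨m + c, fun X f hf e ↦ ?_⟩
    let F' : Submodule R F := a ^ (m + c) • ⊤
    let N' : Submodule R N := a ^ (m + c) • ⊤
    have hFN : Submodule.map p F' = N' := by
      rw [Submodule.map_smul'', Submodule.map_top, LinearMap.range_eq_top.2 hπ]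
    let p' : F' →ₗ[R] N' := p.restrict fun x hx ↦ hFN ▸ Submodule.mem_map_of_mem hx
    have hp' : Function.Surjective p' := by
      rintro ⟨y, hy⟩
      obtain ⟨x, hx, rfl⟩ := hFN.ge hy
      exact ⟨⟨x, hx⟩, rfl⟩
    have hS' := LinearMap.shortExact_shortComplexKer hp'
    let q : LinearMap.ker p' →ₗ[R] LinearMap.ker p :=
      (F'.subtype ∘ₗ (LinearMap.ker p').subtype).codRestrict _ fun x ↦
        congrArg Subtype.val x.2
    have hq : LinearMap.range q ≤ a ^ m • ⊤ := by
      rintro _ ⟨x, rfl⟩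
      have h₁ : ((x : F') : F) ∈ a ^ m • LinearMap.ker p := by
        have : ((x : F') : F) ∈ a ^ (m + c) • ⊤ ⊓ LinearMap.ker p := ⟨x.1.2, (q x).2⟩
        rw [hc _ (Nat.le_add_left c m), Nat.add_sub_cancel] at this
        exact Submodule.smul_mono le_rfl inf_le_right this
      have h₂ : Submodule.map (LinearMap.ker p).subtype (a ^ m • ⊤) = a ^ m • LinearMap.ker p := by
        rw [Submodule.map_smul'', Submodule.map_top, Submodule.range_subtype]
      obtain ⟨y, hy, hyx⟩ := h₂.ge h₁
      have : y = q x := Subtype.ext hyx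
      exact this ▸ hy
    let φ : p'.shortComplexKer ⟶ p.shortComplexKer :=
      { τ₁ := ModuleCat.ofHom q
        τ₂ := ModuleCat.ofHom F'.subtype
        τ₃ := ModuleCat.ofHom N'.subtype
        comm₁₂ := rfl
        comm₂₃ := rfl }
    have : Projective p.shortComplexKer.X₂ := inferInstanceAs (Projective F)
    obtain ⟨e', rfl⟩ := exists_extClass_comp_eq hS e
    let f' : X ⟶ ModuleCat.of R N' :=
      ModuleCat.ofHom (f.hom.codRestrict N' fun x ↦ hf ⟨x, rfl⟩)
    have hf' : f = f' ≫ φ.τ₃ := rfl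
    rw [hf', ← Abelian.Ext.mk₀_comp_mk₀_assoc,
      mk₀_comp_extClass_comp_eq_zero hS' hS φ (hm _ _ hq e'), Abelian.Ext.comp_zero]

/-- The system `n ↦ Ext (R ⧸ a ^ n) G (i + 1)` is essentially zero when a power of `a`
kills `G`. -/
theorem exists_transition_eq_zero [IsNoetherianRing R] {G : ModuleCat.{u} R} {k : ℕ}
    (hG : ∀ r ∈ a ^ k, ∀ x : G, r • x = 0) (i n : ℕ)
    (e : Abelian.Ext (powQuot a n) G (i + 1)) :
    ∃ m, ∃ h : n ≤ m, transition a G (i + 1) n m h e = 0 := by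
  let S (n : ℕ) : ShortComplex (ModuleCat.{u} R) := (a ^ n).mkQ.shortComplexKer
  have hS (n : ℕ) : (S n).ShortExact :=
    LinearMap.shortExact_shortComplexKer (Submodule.mkQ_surjective _)
  have (n : ℕ) : Projective (S n).X₂ := inferInstanceAs (Projective (ModuleCat.of R R))
  obtain ⟨e', rfl⟩ := exists_extClass_comp_eq (hS n) e
  obtain ⟨m, hm⟩ := ext_comp_eq_zero_of_range_le_pow_smul a hG i (S n).X₁
  have hker (n : ℕ) : LinearMap.ker (a ^ n).mkQ = a ^ n := Submodule.ker_mkQ _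
  have hle : LinearMap.ker (a ^ (m + n)).mkQ ≤ LinearMap.ker (a ^ n).mkQ := by
    rw [hker, hker]
    exact Ideal.pow_le_pow_right (Nat.le_add_left n m)
  let φ : S (m + n) ⟶ S n :=
    { τ₁ := ModuleCat.ofHom (Submodule.inclusion hle)
      τ₂ := 𝟙 _
      τ₃ := powQuotMap a (Nat.le_add_left n m)
      comm₁₂ := rfl
      comm₂₃ := rfl }
  have hφ : LinearMap.range φ.τ₁.hom ≤ a ^ m • ⊤ := by
    have h : Submodule.map (LinearMap.ker (a ^ n).mkQ).subtype (a ^ m • ⊤) =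
        LinearMap.ker (a ^ (m + n)).mkQ := by
      rw [Submodule.map_smul'', Submodule.map_top, Submodule.range_subtype, hker, hker, pow_add,
        smul_eq_mul]
    rintro _ ⟨x, rfl⟩
    obtain ⟨y, hy, hyx⟩ := h.ge x.2
    have : y = φ.τ₁.hom x := Subtype.ext hyx
    exact this ▸ hy
  exact ⟨m + n, Nat.le_add_left n m,
    mk₀_comp_extClass_comp_eq_zero (hS _) (hS n) φ (hm _ _ hφ e')⟩

lemma smul_ext_eq_zero {X Y : ModuleCat.{u} R} {r : R} (hX : ∀ x : X, r • x = 0) {i : ℕ}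
    (e : Abelian.Ext X Y i) : r • e = 0 := by
  have hr : r • 𝟙 X = 0 := by
    ext x
    exact hX x
  rw [← e.mk₀_id_comp, ← Abelian.Ext.smul_comp, ← Abelian.Ext.mk₀_smul, hr,
    Abelian.Ext.mk₀_zero, Abelian.Ext.zero_comp]

/-- If a scalar acts as zero on `X` and invertibly on `Y`, then all `Ext` from `X` to `Y` vanish. -/
theorem ext_eq_zero_of_smul {X Y : ModuleCat.{u} R} {r : R} (hX : ∀ x : X, r • x = 0)
    (hY : Function.Bijective fun y : Y ↦ r • y) {i : ℕ} (e : Abelian.Ext X Y i) : e = 0 := by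
  let ψ := ModuleCat.ofHom (LinearEquiv.ofBijective (LinearMap.lsmul R Y r) hY).symm.toLinearMap
  have hψ : r • ψ = 𝟙 Y := by
    ext y
    exact (LinearEquiv.ofBijective (LinearMap.lsmul R Y r) hY).apply_symm_apply y
  rw [← e.comp_mk₀_id, ← hψ, Abelian.Ext.mk₀_smul, Abelian.Ext.comp_smul,
    ← Abelian.Ext.smul_comp, smul_ext_eq_zero hX, Abelian.Ext.zero_comp]

theorem ext_pi_eq_zero {ι : Type u} [Fintype ι] {X : ModuleCat.{u} R} {Y : ι → ModuleCat.{u} R}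
    {i : ℕ} (h : ∀ j, ∀ e : Abelian.Ext X (Y j) i, e = 0)
    (e : Abelian.Ext X (ModuleCat.of R (∀ j, Y j)) i) : e = 0 := by
  classical
  let p (j : ι) : ModuleCat.of R (∀ j, Y j) ⟶ Y j := ModuleCat.ofHom (LinearMap.proj j)
  let s (j : ι) : Y j ⟶ ModuleCat.of R (∀ j, Y j) :=
    ModuleCat.ofHom (LinearMap.single R (fun j ↦ Y j) j)
  have hps : ∑ j, p j ≫ s j = 𝟙 _ := by
    ext x
    simp [p, s, ModuleCat.hom_sum]
  rw [← e.comp_mk₀_id, ← hps, Abelian.Ext.mk₀_sum, Abelian.Ext.comp_sum]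
  refine Finset.sum_eq_zero fun j _ ↦ ?_
  rw [← Abelian.Ext.mk₀_comp_mk₀, ← Abelian.Ext.comp_assoc_of_third_deg_zero,
    h j (e.comp _ _), Abelian.Ext.zero_comp]

end PowExt

section

variable {R : Type*} [Semiring R] {ι : Type*} [Preorder ι] [IsDirectedOrder ι] [Nonempty ι]
  [DecidableEq ι] {G G' : ι → Type*} [∀ i, AddCommGroup (G i)] [∀ i, Module R (G i)]
  [∀ i, AddCommGroup (G' i)] [∀ i, Module R (G' i)]
  {f : ∀ i j, i ≤ j → G i →ₗ[R] G j} {f' : ∀ i j, i ≤ j → G' i →ₗ[R] G' j}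
  [DirectedSystem G' (f' · · ·)] (g : ∀ i, G i →ₗ[R] G' i)
  (hg : ∀ i j h, g j ∘ₗ f i j h = f' i j h ∘ₗ g i)

theorem Module.DirectLimit.map_bijective
    (h : ∀ i x, g i x = 0 → ∃ j, ∃ hij : i ≤ j, f i j hij x = 0)
    (h' : ∀ i y, ∃ j, ∃ hij : i ≤ j, ∃ x, g j x = f' i j hij y) :
    Function.Bijective (Module.DirectLimit.map g hg) := by
  constructor
  · rw [injective_iff_map_eq_zero]
    intro z hz
    obtain ⟨i, x, rfl⟩ := Module.DirectLimit.exists_of z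
    rw [Module.DirectLimit.map_apply_of] at hz
    obtain ⟨j, hij, hj⟩ := Module.DirectLimit.of.zero_exact hz
    obtain ⟨k, hjk, hk⟩ := h j (f i j hij x) ((LinearMap.congr_fun (hg i j hij) x).trans hj)
    rw [← Module.DirectLimit.of_f (hij := hij), ← Module.DirectLimit.of_f (hij := hjk), hk,
      map_zero]
  · intro z
    obtain ⟨i, y, rfl⟩ := Module.DirectLimit.exists_of z
    obtain ⟨j, hij, x, hx⟩ := h' i y
    exact ⟨Module.DirectLimit.of R ι G f j x, by
      rw [Module.DirectLimit.map_apply_of, hx, Module.DirectLimit.of_f]⟩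

end

namespace PowExt

variable {R : Type u} [CommRing R] (a : Ideal R) {M M' : ModuleCat.{u} R}

section

variable {d i j : ℕ} (α : Abelian.Ext M M' d) (h : i + d = j)

lemma transition_comp {m n : ℕ} (hmn : m ≤ n) (x : Abelian.Ext (powQuot a m) M i) :
    (transition a M i m n hmn x).comp α h = transition a M' j m n hmn (x.comp α h) := by
  simp only [transition_apply]
  exact Abelian.Ext.comp_assoc _ _ _ _ _ (by lia)

/-- The map of direct limits given by composition with an extension class. -/
def limPostcomp : LimExt a M i →ₗ[R] LimExt a M' j :=
  Module.DirectLimit.map (fun n ↦ α.postcompOfLinear R (powQuot a n) h)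
    fun _ _ hmn ↦ LinearMap.ext fun x ↦ transition_comp a α h hmn x

lemma limPostcomp_bijective
    (h₁ : ∀ n, ∀ x : Abelian.Ext (powQuot a n) M i, x.comp α h = 0 →
      ∃ m, ∃ hnm : n ≤ m, transition a M i n m hnm x = 0)
    (h₂ : ∀ n, ∀ y : Abelian.Ext (powQuot a n) M' j,
      ∃ m, ∃ hnm : n ≤ m, ∃ x : Abelian.Ext (powQuot a m) M i,
        x.comp α h = transition a M' j n m hnm y) :
    Function.Bijective (limPostcomp a α h) :=
  Module.DirectLimit.map_bijective _ _ h₁ h₂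

end

lemma finite_ext_X₃ [IsNoetherianRing R] {S : ShortComplex (ModuleCat.{u} R)}
    (hS : S.ShortExact) (X : ModuleCat.{u} R) (i : ℕ)
    [Module.Finite R (Abelian.Ext X S.X₂ i)] [Module.Finite R (Abelian.Ext X S.X₁ (i + 1))] :
    Module.Finite R (Abelian.Ext X S.X₃ i) := by
  have := isNoetherian_of_range_eq_ker
    ((Abelian.Ext.mk₀ S.g).postcompOfLinear R X (add_zero i))
    (hS.extClass.postcompOfLinear R X rfl) (by
      ext x
      constructor
      · rintro ⟨y, rfl⟩
        change (y.comp (Abelian.Ext.mk₀ S.g) (add_zero i)).comp hS.extClass rfl = 0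
        rw [Abelian.Ext.comp_assoc_of_second_deg_zero, hS.comp_extClass, Abelian.Ext.comp_zero]
      · exact fun hx ↦ Abelian.Ext.covariant_sequence_exact₃ X hS x rfl hx)
  infer_instance

lemma limPostcomp_mk₀_bijective [IsNoetherianRing R] {S : ShortComplex (ModuleCat.{u} R)}
    (hS : S.ShortExact) {k : ℕ}
    (hk : ∀ r ∈ a ^ k, ∀ x : S.X₁, r • x = 0) (i : ℕ) :
    Function.Bijective (limPostcomp a (Abelian.Ext.mk₀ S.g) (add_zero (i + 1))) := by
  refine limPostcomp_bijective _ _ _ (fun n x hx ↦ ?_) (fun n y ↦ ?_)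
  · obtain ⟨x, rfl⟩ := Abelian.Ext.covariant_sequence_exact₂ _ hS x hx
    obtain ⟨m, hnm, hm⟩ := exists_transition_eq_zero a hk i n x
    refine ⟨m, hnm, ?_⟩
    rw [← transition_comp, hm, Abelian.Ext.zero_comp]
  · obtain ⟨m, hnm, hm⟩ := exists_transition_eq_zero a hk (i + 1) n (y.comp hS.extClass rfl)
    rw [← transition_comp] at hm
    exact ⟨m, hnm, Abelian.Ext.covariant_sequence_exact₃ _ hS _ rfl hm⟩

lemma postcomp_extClass_bijective {S : ShortComplex (ModuleCat.{u} R)} (hS : S.ShortExact)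
    {X : ModuleCat.{u} R} (h : ∀ i, ∀ e : Abelian.Ext X S.X₂ i, e = 0) (i : ℕ) :
    Function.Bijective (hS.extClass.postcompOfLinear R X (rfl : i + 1 = i + 1)) := by
  constructor
  · rw [injective_iff_map_eq_zero]
    intro x hx
    obtain ⟨x, rfl⟩ := Abelian.Ext.covariant_sequence_exact₃ _ hS x rfl hx
    rw [h i x, Abelian.Ext.zero_comp]
  · intro y
    exact Abelian.Ext.covariant_sequence_exact₁ _ hS y (h _ _) rfl

lemma limPostcomp_extClass_bijective {S : ShortComplex (ModuleCat.{u} R)} (hS : S.ShortExact)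
    (h : ∀ n i, ∀ e : Abelian.Ext (powQuot a n) S.X₂ i, e = 0) (i : ℕ) :
    Function.Bijective (limPostcomp a hS.extClass (rfl : i + 1 = i + 1)) := by
  refine limPostcomp_bijective _ _ _ (fun n x hx ↦ ⟨n, le_rfl, ?_⟩) (fun n y ↦ ⟨n, le_rfl, ?_⟩)
  · have : x = 0 := (postcomp_extClass_bijective hS (h n) i).1 (hx.trans (map_zero _).symm)
    rw [this, map_zero]
  · exact (postcomp_extClass_bijective hS (h n) i).2 _

end PowExt

namespace PowExt

variable {R : Type u} [CommRing R] (a : Ideal R) {M : ModuleCat.{u} R}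

/-- The morphism out of `R ⧸ a ^ n` sending `1` to an element killed by `a ^ n`. -/
def powQuotDesc (n : ℕ) (m : M) (hm : ∀ r ∈ a ^ n, r • m = 0) : powQuot a n ⟶ M :=
  ModuleCat.ofHom (Submodule.liftQ _ (LinearMap.toSpanSingleton R M m) hm)

lemma powQuotDesc_one (n : ℕ) (m : M) (hm : ∀ r ∈ a ^ n, r • m = 0) :
    (powQuotDesc a n m hm).hom (1 : R ⧸ a ^ n) = m :=
  one_smul R m

lemma pow_smul_hom_one {n : ℕ} (f : powQuot a n ⟶ M) {r : R} (hr : r ∈ a ^ n) :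
    r • f.hom (1 : R ⧸ a ^ n) = 0 := by
  rw [← map_smul]
  exact (congrArg f.hom (pow_smul_powQuot a hr _)).trans (map_zero _)

lemma powQuot_hom_ext {n : ℕ} {f g : powQuot a n ⟶ M}
    (h : f.hom (1 : R ⧸ a ^ n) = g.hom (1 : R ⧸ a ^ n)) : f = g := by
  ext : 1
  refine Submodule.linearMap_qext _ (LinearMap.ext_ring h)

variable (M)

/-- The value at `1` identifies degree zero extensions of `R ⧸ a ^ n` with `a ^ n`-torsion. -/
def evalOne (n : ℕ) : Abelian.Ext (powQuot a n) M 0 →ₗ[R] M :=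
  (LinearMap.applyₗ (1 : R ⧸ a ^ n)).comp
    (Abelian.Ext.linearEquiv₀.trans ModuleCat.homLinearEquiv).toLinearMap

lemma evalOne_mk₀ (n : ℕ) (f : powQuot a n ⟶ M) :
    evalOne a M n (Abelian.Ext.mk₀ f) = f.hom (1 : R ⧸ a ^ n) :=
  congrArg (fun g : powQuot a n ⟶ M ↦ g.hom (1 : R ⧸ a ^ n))
    (Abelian.Ext.linearEquiv₀ (R := R).apply_symm_apply f)

lemma evalOne_injective (n : ℕ) : Function.Injective (evalOne a M n) := by
  intro x y h
  obtain ⟨f, rfl⟩ := (Abelian.Ext.mk₀_bijective _ _).2 x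
  obtain ⟨g, rfl⟩ := (Abelian.Ext.mk₀_bijective _ _).2 y
  rw [evalOne_mk₀, evalOne_mk₀] at h
  rw [powQuot_hom_ext a h]

lemma mem_range_evalOne {n : ℕ} {m : M} :
    m ∈ LinearMap.range (evalOne a M n) ↔ ∀ r ∈ a ^ n, r • m = 0 := by
  constructor
  · rintro ⟨x, rfl⟩ r hr
    obtain ⟨f, rfl⟩ := (Abelian.Ext.mk₀_bijective _ _).2 x
    rw [evalOne_mk₀]
    exact pow_smul_hom_one a f hr
  · intro h
    refine ⟨Abelian.Ext.mk₀ (powQuotDesc a n m h), ?_⟩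
    rw [evalOne_mk₀, powQuotDesc_one]

lemma evalOne_transition {m n : ℕ} (h : m ≤ n) (x : Abelian.Ext (powQuot a m) M 0) :
    evalOne a M n (transition a M 0 m n h x) = evalOne a M m x := by
  obtain ⟨f, rfl⟩ := (Abelian.Ext.mk₀_bijective _ _).2 x
  rw [transition_apply, Abelian.Ext.mk₀_comp_mk₀, evalOne_mk₀, evalOne_mk₀]
  rfl

/-- The zeroth local cohomology of `M` as a submodule of `M`. -/
def limEvalOne : LimExt a M 0 →ₗ[R] M :=
  Module.DirectLimit.lift R ℕ _ _ (evalOne a M) fun _ _ h x ↦ evalOne_transition a M h x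

lemma limEvalOne_injective : Function.Injective (limEvalOne a M) :=
  Module.DirectLimit.lift_injective _ _ (evalOne_injective a M)

lemma mem_range_limEvalOne {m : M} :
    m ∈ LinearMap.range (limEvalOne a M) ↔ ∃ n, ∀ r ∈ a ^ n, r • m = 0 := by
  constructor
  · rintro ⟨x, rfl⟩
    obtain ⟨n, x, rfl⟩ := Module.DirectLimit.exists_of x
    refine ⟨n, (mem_range_evalOne a M).1 ⟨x, ?_⟩⟩
    rw [limEvalOne, Module.DirectLimit.lift_of]
  · rintro ⟨n, hn⟩
    obtain ⟨x, hx⟩ := (mem_range_evalOne a M).2 hn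
    exact ⟨Module.DirectLimit.of R ℕ _ _ n x, by rw [limEvalOne, Module.DirectLimit.lift_of, hx]⟩

end PowExt

namespace PowExt

variable {R : Type u} [CommRing R]

/-- The short complex `0 → M → N → N ⧸ M → 0` attached to an injective linear map. -/
abbrev quotientComplex {M N : Type u} [AddCommGroup M] [Module R M] [AddCommGroup N] [Module R N]
    (f : M →ₗ[R] N) : ShortComplex (ModuleCat.{u} R) :=
  ModuleCat.shortComplexOfCompEqZero f f.range.mkQ (LinearMap.range_mkQ_comp f)

lemma shortExact_quotientComplex {M N : Type u} [AddCommGroup M] [Module R M] [AddCommGroup N]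
    [Module R N] {f : M →ₗ[R] N} (hf : Function.Injective f) : (quotientComplex f).ShortExact :=
  ModuleCat.shortComplex_shortExact _ (LinearMap.exact_map_mkQ_range f) hf
    (Submodule.mkQ_surjective _)

lemma finite_torsionBySet_of_injective [IsNoetherianRing R] {M N : Type*} [AddCommGroup M]
    [Module R M] [AddCommGroup N] [Module R N] (f : M →ₗ[R] N) (hf : Function.Injective f)
    (s : Set R) [Module.Finite R (Submodule.torsionBySet R N s)] :
    Module.Finite R (Submodule.torsionBySet R M s) := by
  let g : Submodule.torsionBySet R M s →ₗ[R] Submodule.torsionBySet R N s :=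
    f.restrict fun x hx ↦ (Submodule.mem_torsionBySet_iff _ _).2 fun r ↦ by
      rw [← map_smul, (Submodule.mem_torsionBySet_iff _ _).1 hx r, map_zero]
  exact Module.Finite.of_injective g fun x y h ↦ Subtype.ext (hf congr(($h : N)))

variable (a : Ideal R) (M : ModuleCat.{u} R)

lemma exists_pow_smul_limExt_zero [Module.Finite R (LimExt a M 0)] :
    ∃ k, ∀ r ∈ a ^ k, ∀ x : LimExt a M 0, r • x = 0 := by
  obtain ⟨s, hs⟩ := Module.Finite.fg_top (R := R) (M := LimExt a M 0)
  choose n hn using fun x : LimExt a M 0 ↦ (mem_range_limEvalOne a M).1 ⟨x, rfl⟩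
  refine ⟨s.sup n, fun r hr x ↦ ?_⟩
  have hle : Submodule.span R (s : Set (LimExt a M 0)) ≤ LinearMap.ker (LinearMap.lsmul R _ r) :=
    Submodule.span_le.2 fun y hy ↦ limEvalOne_injective a M (by
      rw [map_zero, LinearMap.lsmul_apply, map_smul]
      exact hn y r (Ideal.pow_le_pow_right (Finset.le_sup hy) hr))
  exact hle (hs ▸ Submodule.mem_top)

lemma torsion_quotient_limExt_zero {k : ℕ} (hk : ∀ r ∈ a ^ k, ∀ x : LimExt a M 0, r • x = 0)
    {n : ℕ} {m : (quotientComplex (limEvalOne a M)).X₃} (hm : ∀ r ∈ a ^ n, r • m = 0) : m = 0 := by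
  obtain ⟨m, rfl⟩ := Submodule.mkQ_surjective _ m
  refine (Submodule.Quotient.mk_eq_zero _).2 ((mem_range_limEvalOne a M).2 ⟨k + n, ?_⟩)
  have h : a ^ (k + n) ≤ LinearMap.ker (LinearMap.toSpanSingleton R M m) := by
    rw [pow_add, Ideal.mul_le]
    intro r hr s hs
    obtain ⟨x, hx⟩ := (Submodule.Quotient.mk_eq_zero _).1 (hm s hs)
    change (r * s) • m = 0
    rw [mul_smul]
    exact (congrArg (r • ·) hx).symm.trans (((limEvalOne a M).map_smul r x).symm.trans
      (by rw [hk r hr, map_zero]))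
  exact h

/-- The product of the localizations of `M` at the elements of a finite set. -/
abbrev localizationPi (s : Finset R) : ModuleCat.{u} R :=
  ModuleCat.of R (∀ r : s, ModuleCat.of R (LocalizedModule (Submonoid.powers (r : R)) M))

/-- The canonical map to the product of the localizations. -/
abbrev toLocalizationPi (s : Finset R) : M →ₗ[R] localizationPi M s :=
  LinearMap.pi fun r : s ↦ LocalizedModule.mkLinearMap (Submonoid.powers (r : R)) M

variable {a M}

lemma toLocalizationPi_injective {s : Finset R} (hs : Ideal.span s = a)
    (hM : ∀ m : M, ∀ n, (∀ r ∈ a ^ n, r • m = 0) → m = 0) :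
    Function.Injective (toLocalizationPi M s) := by
  rw [injective_iff_map_eq_zero]
  intro m hm
  let I := LinearMap.ker (LinearMap.toSpanSingleton R M m)
  have h : a ≤ Ideal.radical I := by
    rw [← hs, Ideal.span_le]
    intro r hr
    obtain ⟨⟨_, n, rfl⟩, hc⟩ := (IsLocalizedModule.eq_zero_iff (Submonoid.powers r)
      (LocalizedModule.mkLinearMap (Submonoid.powers r) M)).1 (congrFun hm ⟨r, hr⟩)
    exact ⟨n, hc⟩
  obtain ⟨n, hn⟩ := Ideal.exists_pow_le_of_le_radical_of_fg h ⟨s, hs⟩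
  exact hM m n hn

lemma ext_localizationPi_eq_zero {s : Finset R} (hs : Ideal.span s = a) (n i : ℕ)
    (e : Abelian.Ext (powQuot a n) (localizationPi M s) i) : e = 0 := by
  refine ext_pi_eq_zero (ι := s)
    (Y := fun r : s ↦ ModuleCat.of R (LocalizedModule (Submonoid.powers (r : R)) M))
    (fun r e ↦ ext_eq_zero_of_smul (r := (r : R) ^ n) (pow_smul_powQuot a
      (Ideal.pow_mem_pow (hs ▸ Ideal.subset_span r.2) n)) ?_ e) e
  let p : Submonoid.powers (r : R) := ⟨(r : R) ^ n, n, rfl⟩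
  exact (Module.End.isUnit_iff _).1
    (IsLocalizedModule.map_units (LocalizedModule.mkLinearMap (Submonoid.powers (r : R)) M) p)

variable (a M)

/-- Dimension shifting along the embedding of an `a`-torsion-free module into a product of
localizations, whose local cohomology vanishes. -/
lemma exists_limExt_equiv_of_torsionFree [IsNoetherianRing R]
    (hM : ∀ m : M, ∀ n, (∀ r ∈ a ^ n, r • m = 0) → m = 0) :
    ∃ L : ModuleCat.{u} R,
      (∀ i, Nonempty (Abelian.Ext (powQuot a 1) L i ≃ₗ[R] Abelian.Ext (powQuot a 1) M (i + 1))) ∧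
      ∀ i, Nonempty (LimExt a L i ≃ₗ[R] LimExt a M (i + 1)) := by
  obtain ⟨s, hs⟩ := (inferInstance : IsNoetherian R R).noetherian a
  have hT := shortExact_quotientComplex (toLocalizationPi_injective hs hM)
  have h0 := ext_localizationPi_eq_zero (M := M) hs
  exact ⟨(quotientComplex (toLocalizationPi M s)).X₃,
    fun i ↦ ⟨.ofBijective _ (postcomp_extClass_bijective hT (h0 1) i)⟩,
    fun i ↦ ⟨.ofBijective _ (limPostcomp_extClass_bijective a hT h0 i)⟩⟩

/-- Dividing out the `a`-torsion does not change local cohomology in positive degrees. -/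
lemma exists_limExt_equiv_torsionFree [IsNoetherianRing R] [Module.Finite R (LimExt a M 0)]
    (hE : ∀ i, Module.Finite R (Abelian.Ext (powQuot a 1) M i)) :
    ∃ M' : ModuleCat.{u} R, (∀ m : M', ∀ n, (∀ r ∈ a ^ n, r • m = 0) → m = 0) ∧
      (∀ i, Module.Finite R (Abelian.Ext (powQuot a 1) M' i)) ∧
      ∀ i, Nonempty (LimExt a M (i + 1) ≃ₗ[R] LimExt a M' (i + 1)) := by
  obtain ⟨k, hk⟩ := exists_pow_smul_limExt_zero a M
  have hS := shortExact_quotientComplex (limEvalOne_injective a M)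
  refine ⟨(quotientComplex (limEvalOne a M)).X₃, fun m n ↦ torsion_quotient_limExt_zero a M hk,
    fun i ↦ ?_, fun i ↦ ⟨.ofBijective _ (limPostcomp_mk₀_bijective a hS hk i)⟩⟩
  have := hE i
  have : Module.Finite R
      (Abelian.Ext (powQuot a 1) (quotientComplex (limEvalOne a M)).X₁ (i + 1)) :=
    ModuleCat.finite_ext R (powQuot a 1) (ModuleCat.of R (LimExt a M 0)) (i + 1)
  exact finite_ext_X₃ hS (powQuot a 1) i

/-- The `a`-torsion of the first local cohomology module that need not be finite is finite. -/
theorem finite_torsionBySet_limExt [IsNoetherianRing R] (t : ℕ)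
    (hE : ∀ i, Module.Finite R (Abelian.Ext (powQuot a 1) M i))
    (hM : ∀ i < t, Module.Finite R (LimExt a M i)) :
    Module.Finite R (Submodule.torsionBySet R (LimExt a M t) (a : Set R)) := by
  induction t generalizing M with
  | zero =>
    let f : Submodule.torsionBySet R (LimExt a M 0) (a : Set R) →ₗ[R]
        LinearMap.range (evalOne a M 1) :=
      (limEvalOne a M ∘ₗ Submodule.subtype _).codRestrict _ fun x ↦
        (mem_range_evalOne a M).2 fun r hr ↦ by
          rw [pow_one] at hr
          rw [← map_smul]
          exact (congrArg _ ((Submodule.mem_torsionBySet_iff _ _).1 x.2 ⟨r, hr⟩)).trans (map_zero _)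
    have := hE 0
    exact Module.Finite.of_injective f fun x y h ↦
      Subtype.ext (limEvalOne_injective a M congr(($h : M)))
  | succ t ih =>
    have := hM 0 t.succ_pos
    obtain ⟨M', hM', hE', e⟩ := exists_limExt_equiv_torsionFree a M hE
    obtain ⟨L, f, g⟩ := exists_limExt_equiv_of_torsionFree a M' hM'
    let φ (i : ℕ) : LimExt a M (i + 1) ≃ₗ[R] LimExt a L i := (e i).some ≪≫ₗ (g i).some.symm
    have := ih L
      (fun i ↦ have := hE' (i + 1); Module.Finite.equiv (f i).some.symm)
      (fun i hi ↦ have := hM (i + 1) (by lia); Module.Finite.equiv (φ i))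
    exact finite_torsionBySet_of_injective (φ t).toLinearMap (φ t).injective _

lemma exists_pow_smul_limExt_eq_zero {i : ℕ} (x : LimExt a M i) :
    ∃ n, ∀ r ∈ a ^ n, r • x = 0 := by
  obtain ⟨n, x, rfl⟩ := Module.DirectLimit.exists_of x
  exact ⟨n, fun r hr ↦ by
    rw [← map_smul, smul_ext_eq_zero (pow_smul_powQuot a hr), map_zero]⟩

/-- An `a`-power-torsion module with finite `a`-torsion has finitely many associated primes. -/
lemma associatedPrimes_finite_of_torsionBySet [IsNoetherianRing R] {N : Type*}
    [AddCommGroup N] [Module R N] (hN : ∀ x : N, ∃ n, ∀ r ∈ a ^ n, r • x = 0)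
    [Module.Finite R (Submodule.torsionBySet R N (a : Set R))] :
    (associatedPrimes R N).Finite := by
  refine (associatedPrimes.finite R (Submodule.torsionBySet R N (a : Set R))).subset ?_
  intro P hP
  obtain ⟨hp, x, hx⟩ := isAssociatedPrime_iff.1 hP
  obtain ⟨n, hn⟩ := hN x
  have hmem (r : R) : r ∈ P ↔ r • x = 0 := by rw [hx]; simp [Submodule.mem_colon_singleton]
  have hle : a ≤ P := hp.le_of_pow_le fun r hr ↦ (hmem r).2 (hn r hr)
  have hx' : x ∈ Submodule.torsionBySet R N (a : Set R) :=
    (Submodule.mem_torsionBySet_iff _ _).2 fun r ↦ (hmem r).1 (hle r.2)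
  refine isAssociatedPrime_iff.2 ⟨hp, ⟨x, hx'⟩, ?_⟩
  ext r
  simp [Submodule.mem_colon_singleton, hmem]

end PowExt

end

/-- Brodmann–Lashgari: if `M` is finitely generated and `H_a^0(M), …,
`H_a^{t-1}(M)` are all finitely generated, then `Ass H_a^t(M)` is finite. -/
theorem associatedPrimes_finite_of_fg_below
    {R : Type} [CommRing R] [IsNoetherianRing R] (a : Ideal R)
    (M : Type) [AddCommGroup M] [Module R M] [Module.Finite R M] (t : ℕ)
    (hf : ∀ i < t,
      Module.Finite R ((localCohomology a i).obj (ModuleCat.of R M))) :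
    (associatedPrimes R ((localCohomology a t).obj (ModuleCat.of R M))).Finite := by
  have := PowExt.finite_torsionBySet_limExt a (ModuleCat.of R M) t
    (fun i ↦ ModuleCat.finite_ext ..) fun i hi ↦ by
      have := hf i hi
      exact Module.Finite.equiv (PowExt.limExtEquiv a (ModuleCat.of R M) i).symm
  rw [← LinearEquiv.AssociatedPrimes.eq (PowExt.limExtEquiv a (ModuleCat.of R M) t)]
  exact PowExt.associatedPrimes_finite_of_torsionBySet a
    (PowExt.exists_pow_smul_limExt_eq_zero a (ModuleCat.of R M))
end
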